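/- arXiv:2101.01003 — 3 statements merged into one kernel-verified Lean document; each statement's English description precedes it below -/
import Mathlib

section
/- Assume p is odd, let a ∈ GF(Q)* and set E = G(a)^2 - 4a·F(a)^{q+1}. Then: (1) N_a = 0 if and only if E^{(p^d - 1)/2} ∉ {0, 1}; (2) N_a = 1 if and only if F(a) ≠ 0 and E = 0, and in this case the unique zero of P_a(X) in GF(Q) is -G(a)/(2F(a)); (3) N_a = 2 if and only if E^{(p^d - 1)/2} = 1, and in this case E has a square root E^{1/2} lying in GF(p^d) and the two zeros of P_a(X) in GF(Q) are (E^{1/2} - G(a))/(2F(a)) and (-E^{1/2} - G(a))/(2F(a)). -/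
open Polynomial

section TwistedSequence

variable {K : Type*} [Field K]

/-- The values `A_r(a)` of the polynomials `A_{r+2} = -A_{r+1}^q - X^q A_r^{q^2}`, extended by
`A_0(a) = 0`, for an arbitrary field endomorphism `σ` in place of `x ↦ x ^ q`. -/
def twistedSeq (σ : K →+* K) (a : K) : ℕ → K
  | 0 => 0
  | 1 => 1
  | r + 2 => -σ (twistedSeq σ a (r + 1)) - σ a * σ (σ (twistedSeq σ a r))

variable (σ : K →+* K) (a : K)

theorem twistedSeq_add_two (r : ℕ) : twistedSeq σ a (r + 2) =
    -σ (twistedSeq σ a (r + 1)) - σ a * σ (σ (twistedSeq σ a r)) := by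
  rw [twistedSeq]

theorem twistedSeq_add_two_linear (r : ℕ) : twistedSeq σ a (r + 2) =
    -twistedSeq σ a (r + 1) - σ^[r] a * twistedSeq σ a r := by
  induction r using Nat.twoStepInduction with
  | zero => simp [twistedSeq]
  | one => simp [twistedSeq]
  | more r ih0 ih1 =>
    have h3 := twistedSeq_add_two σ a (r + 1)
    have h2 := twistedSeq_add_two σ a r
    have e1 := congrArg σ ih1
    have e0 := congrArg (fun x => σ (σ x)) ih0
    rw [twistedSeq_add_two σ a (r + 2)]
    simp only [map_sub, map_neg, map_mul, ← Function.iterate_succ_apply'] at e0 e1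
    simp only [Nat.add_assoc, Nat.reduceAdd, Nat.succ_eq_add_one] at *
    linear_combination -e1 - σ a * e0 + h3 + σ^[r + 2] a * h2

/-- Iterating `σ x = -(x + a) / x`. -/
theorem iterate_mul_twistedSeq {x : K} (hx : σ x * x + x + a = 0) (r : ℕ) :
    σ^[r + 1] x * (twistedSeq σ a (r + 1) * x - a * σ (twistedSeq σ a r)) =
      twistedSeq σ a (r + 2) * x - a * σ (twistedSeq σ a (r + 1)) := by
  induction r with
  | zero => simp [twistedSeq]; linear_combination hx
  | succ r ih =>
    have e := congrArg (fun y => σ y) ih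
    simp only [map_sub, map_mul, ← Function.iterate_succ_apply'] at e
    rw [twistedSeq_add_two σ a (r + 1), twistedSeq_add_two σ a r] at *
    simp only [map_sub, map_neg, map_mul, Nat.succ_eq_add_one] at *
    linear_combination x * e - (σ^[r + 1 + 1] x * σ (twistedSeq σ a (r + 1)) +
      σ (σ (twistedSeq σ a (r + 1))) + σ (σ a) * σ (σ (σ (twistedSeq σ a r)))) * hx

theorem map_twistedSeq_trace {l : ℕ} (ha : σ^[l + 1] a = a) {G : K}
    (hG : G = -twistedSeq σ a (l + 2) - a * σ (twistedSeq σ a l)) :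
    σ G = 2 * σ (twistedSeq σ a (l + 1)) - G := by
  have h1 := twistedSeq_add_two σ a l
  have h2 := congrArg σ (twistedSeq_add_two_linear σ a l)
  simp only [map_sub, map_neg, map_mul, ← Function.iterate_succ_apply', Nat.succ_eq_add_one,
    ha] at h2
  subst hG
  simp only [map_sub, map_neg, map_mul]
  linear_combination -h2 - h1

theorem map_map_twistedSeq {l : ℕ} (ha : σ^[l + 1] a = a) {G : K}
    (hG : G = -twistedSeq σ a (l + 2) - a * σ (twistedSeq σ a l)) :
    σ a * σ (σ (twistedSeq σ a (l + 1))) =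
      a * twistedSeq σ a (l + 1) + σ (twistedSeq σ a (l + 1)) - G := by
  have h1 := twistedSeq_add_two σ a (l + 1)
  have h2 := congrArg σ (twistedSeq_add_two_linear σ a l)
  have h3 := twistedSeq_add_two_linear σ a (l + 1)
  simp only [map_sub, map_neg, map_mul, ← Function.iterate_succ_apply', Nat.succ_eq_add_one,
    ha] at h2
  rw [ha] at h3
  subst hG
  linear_combination h1 - h3 - h2

theorem twistedSeq_succ_ne_zero (ha : a ≠ 0) {r : ℕ} (hr : twistedSeq σ a r = 0) :
    twistedSeq σ a (r + 1) ≠ 0 := by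
  induction r with
  | zero => simp [twistedSeq]
  | succ r ih =>
    intro h
    have h2 := twistedSeq_add_two_linear σ a r
    rw [h, hr] at h2
    have hσ : σ^[r] a ≠ 0 := by
      rw [← RingHom.coe_pow]
      exact (_root_.map_ne_zero _).2 ha
    have h0 : twistedSeq σ a r = 0 := by
      simpa [hσ] using h2
    exact ih h0 hr

theorem twistedSeq_mem {L : Subfield K} (hL : ∀ x ∈ L, σ x ∈ L) (ha : a ∈ L) (r : ℕ) :
    twistedSeq σ a r ∈ L := by
  induction r using Nat.twoStepInduction with
  | zero => exact L.zero_mem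
  | one => exact L.one_mem
  | more r h0 h1 =>
    rw [twistedSeq_add_two]
    exact L.sub_mem (L.neg_mem (hL _ h1)) (L.mul_mem (hL _ ha) (hL _ (hL _ h0)))

/-- A zero `x` of `σ x * x + x + a` fixed by `σ^[l + 1]` gives a `σ`-fixed square root of the
discriminant. -/
theorem sq_and_map_of_zero {l : ℕ} (ha : σ^[l + 1] a = a) (ha0 : a ≠ 0) {F G : K}
    (hF : F = twistedSeq σ a (l + 1))
    (hG : G = -twistedSeq σ a (l + 2) - a * σ (twistedSeq σ a l))
    {x : K} (hx : σ x * x + x + a = 0) (hxm : σ^[l + 1] x = x) :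
    (2 * F * x + G) ^ 2 = G ^ 2 - 4 * a * (F * σ F) ∧ σ (2 * F * x + G) = 2 * F * x + G := by
  have hx0 : x ≠ 0 := by
    rintro rfl
    exact ha0 (by simpa using hx)
  have h1 := iterate_mul_twistedSeq σ a hx l
  have hσG := map_twistedSeq_trace σ a ha hG
  rw [hxm, ← hF] at h1
  rw [← hF] at hσG
  have hquad : F * x ^ 2 + G * x + a * σ F = 0 := by
    rw [hG]; linear_combination h1
  refine ⟨by linear_combination 4 * F * hquad, mul_right_cancel₀ hx0 ?_⟩
  rw [map_add, map_mul, map_mul, hσG, map_ofNat]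
  linear_combination 2 * σ F * hx - 2 * hquad

theorem zero_of_sq {l : ℕ} (ha : σ^[l + 1] a = a) (h2 : (2 : K) ≠ 0) {F G r : K}
    (hF : F = twistedSeq σ a (l + 1))
    (hG : G = -twistedSeq σ a (l + 2) - a * σ (twistedSeq σ a l)) (hF0 : F ≠ 0)
    (hr : r ^ 2 = G ^ 2 - 4 * a * (F * σ F)) (hσr : σ r = r) :
    σ ((r - G) / (2 * F)) * ((r - G) / (2 * F)) + (r - G) / (2 * F) + a = 0 := by
  have hσG := map_twistedSeq_trace σ a ha hG
  rw [← hF] at hσG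
  have hσF : σ F ≠ 0 := (_root_.map_ne_zero σ).2 hF0
  rw [map_div₀, map_sub, map_mul, map_ofNat, hσr, hσG]
  field_simp
  linear_combination hr

/-- The `σ`-semilinear map `v ↦ c M⁻¹ σ(v)` with `M = !![-1, -a; 1, 0]`. -/
def twistStep (c : K) : K × K →+ K × K where
  toFun v := (c * σ v.2, -(c * (σ v.1 + σ v.2)) / a)
  map_zero' := by simp
  map_add' v w := by
    ext <;> simp <;> ring

theorem twistStep_smul (c x : K) (v : K × K) :
    twistStep σ a c (x • v) = σ x • twistStep σ a c v := by
  ext <;> simp [twistStep] <;> ring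

theorem twistStep_iterate_smul (c x : K) (v : K × K) (i : ℕ) :
    (twistStep σ a c)^[i] (x • v) = σ^[i] x • (twistStep σ a c)^[i] v := by
  induction i with
  | zero => rfl
  | succ i ih => simp only [Function.iterate_succ_apply', ih, twistStep_smul]

theorem twistStep_iterate_formula (ha0 : a ≠ 0) (c : K) (v : K × K) (r : ℕ) :
    twistedSeq σ a (r + 2) * ((twistStep σ a c)^[r + 1] v).1 -
        a * σ (twistedSeq σ a (r + 1)) * ((twistStep σ a c)^[r + 1] v).2 =
      (∏ i ∈ Finset.range (r + 1), σ^[i] c) * σ^[r + 1] v.1 ∧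
    twistedSeq σ a (r + 1) * ((twistStep σ a c)^[r + 1] v).1 -
        a * σ (twistedSeq σ a r) * ((twistStep σ a c)^[r + 1] v).2 =
      (∏ i ∈ Finset.range (r + 1), σ^[i] c) * σ^[r + 1] v.2 := by
  induction r with
  | zero =>
    simp [twistedSeq, twistStep]
    field_simp
    ring
  | succ r ih =>
    have hN : ∏ i ∈ Finset.range (r + 1 + 1), σ^[i] c =
        c * σ (∏ i ∈ Finset.range (r + 1), σ^[i] c) := by
      rw [Finset.prod_range_succ', map_prod, mul_comm]
      simp [Function.iterate_succ_apply']
    rw [hN, Function.iterate_succ_apply' _ (r + 1) v, Function.iterate_succ_apply' _ (r + 1) v.1,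
      Function.iterate_succ_apply' _ (r + 1) v.2]
    generalize ∏ i ∈ Finset.range (r + 1), σ^[i] c = N at *
    generalize (twistStep σ a c)^[r + 1] v = w at *
    have h1 := congrArg σ ih.1
    have h2 := congrArg σ ih.2
    have b3 := twistedSeq_add_two σ a (r + 1)
    have b2 := twistedSeq_add_two σ a r
    simp only [map_sub, map_mul] at h1 h2
    simp only [twistStep, AddMonoidHom.coe_mk, ZeroHom.coe_mk]
    constructor
    · rw [b3]
      field_simp
      linear_combination c * h1
    · rw [b2] at *
      field_simp
      linear_combination c * h2

theorem twistStep_mem {L : Subfield K} (hL : ∀ x ∈ L, σ x ∈ L) (ha : a ∈ L) {c : K} (hc : c ∈ L)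
    {v : K × K} (hv : v.1 ∈ L ∧ v.2 ∈ L) :
    (twistStep σ a c v).1 ∈ L ∧ (twistStep σ a c v).2 ∈ L :=
  ⟨L.mul_mem hc (hL _ hv.2),
    L.div_mem (L.neg_mem (L.mul_mem hc (L.add_mem (hL _ hv.1) (hL _ hv.2)))) ha⟩

theorem twistStep_iterate_mem {L : Subfield K} (hL : ∀ x ∈ L, σ x ∈ L) (ha : a ∈ L) {c : K}
    (hc : c ∈ L) {v : K × K} (hv : v.1 ∈ L ∧ v.2 ∈ L) (i : ℕ) :
    ((twistStep σ a c)^[i] v).1 ∈ L ∧ ((twistStep σ a c)^[i] v).2 ∈ L := by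
  induction i with
  | zero => exact hv
  | succ i ih =>
    rw [Function.iterate_succ_apply']
    exact twistStep_mem σ a hL ha hc ih

/-- Galois descent: if `twistStep` has order `m` on `L × L`, no line contains all its fixed
vectors in `L × L`. -/
theorem exists_fixed_not_on_line {L : Subfield K} (hL : ∀ x ∈ L, σ x ∈ L) (ha : a ∈ L) {c : K}
    (hc : c ∈ L) {m : ℕ} (hm : 0 < m)
    (hper : ∀ v : K × K, v.1 ∈ L → v.2 ∈ L → (twistStep σ a c)^[m] v = v)
    {ζ : K} (hζ : ζ ∈ L) (hinj : Function.Injective fun i : Fin m => σ^[i] ζ)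
    (α β : K) (hαβ : α ≠ 0 ∨ β ≠ 0) :
    ∃ v : K × K, v.1 ∈ L ∧ v.2 ∈ L ∧ twistStep σ a c v = v ∧ α * v.1 + β * v.2 ≠ 0 := by
  obtain ⟨w, hw1, hw2, hw⟩ : ∃ w : K × K, w.1 ∈ L ∧ w.2 ∈ L ∧ α * w.1 + β * w.2 ≠ 0 := by
    rcases hαβ with h | h
    · exact ⟨(1, 0), L.one_mem, L.zero_mem, by simpa using h⟩
    · exact ⟨(0, 1), L.zero_mem, L.one_mem, by simpa using h⟩
  by_contra! hcon
  set Φ := twistStep σ a c with hΦ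
  have key : (fun i : Fin m => α * (Φ^[i] w).1 + β * (Φ^[i] w).2) = 0 := by
    refine Matrix.eq_zero_of_forall_pow_sum_mul_pow_eq_zero hinj fun j => ?_
    have hu : (ζ ^ (j : ℕ) • w).1 ∈ L ∧ (ζ ^ (j : ℕ) • w).2 ∈ L :=
      ⟨L.mul_mem (pow_mem hζ _) hw1, L.mul_mem (pow_mem hζ _) hw2⟩
    have hmem := twistStep_iterate_mem σ a hL ha hc hu
    have h := hcon (∑ i ∈ Finset.range m, Φ^[i] (ζ ^ (j : ℕ) • w))
      (by rw [Prod.fst_sum]; exact sum_mem fun i _ => (hmem i).1)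
      (by rw [Prod.snd_sum]; exact sum_mem fun i _ => (hmem i).2)
      (by
        rw [map_sum]
        simp only [← Function.iterate_succ_apply']
        have h1 := Finset.sum_range_succ (fun i => Φ^[i] (ζ ^ (j : ℕ) • w)) m
        rw [Finset.sum_range_succ', hper _ hu.1 hu.2] at h1
        exact add_right_cancel h1)
    rw [Prod.fst_sum, Prod.snd_sum, Finset.mul_sum, Finset.mul_sum, ← Finset.sum_add_distrib,
      Finset.sum_range] at h
    rw [← h]
    refine Finset.sum_congr rfl fun i _ => ?_
    rw [hΦ, twistStep_iterate_smul, iterate_map_pow]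
    simp only [Prod.smul_fst, Prod.smul_snd, smul_eq_mul]
    ring
  exact hw (by simpa using congrFun key ⟨0, hm⟩)

theorem zero_of_twistStep_fixed (ha0 : a ≠ 0) {c : K} {v : K × K}
    (hv : twistStep σ a c v = v) (hv0 : v ≠ 0) :
    v.2 ≠ 0 ∧ σ (v.1 / v.2) * (v.1 / v.2) + v.1 / v.2 + a = 0 := by
  have h1 : c * σ v.2 = v.1 := congrArg Prod.fst hv
  have h2 : -(c * (σ v.1 + σ v.2)) / a = v.2 := congrArg Prod.snd hv
  have hv2 : v.2 ≠ 0 := by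
    intro h
    rw [h, map_zero, mul_zero] at h1
    exact hv0 (Prod.ext h1.symm h)
  have hσ : σ v.2 ≠ 0 := (_root_.map_ne_zero σ).2 hv2
  refine ⟨hv2, ?_⟩
  rw [div_eq_iff ha0] at h2
  rw [map_div₀]
  field_simp
  linear_combination -σ v.2 * h2 - (σ v.1 + σ v.2) * h1

/-- If `twistedSeq` vanishes at `l + 1`, there are at least three zeros in `L`. -/
theorem three_zeros {L : Subfield K} (hL : ∀ x ∈ L, σ x ∈ L) (ha : a ∈ L) (ha0 : a ≠ 0) {c : K}
    (hc : c ∈ L) {l : ℕ} (hper : ∀ x ∈ L, σ^[l + 1] x = x)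
    {ζ : K} (hζ : ζ ∈ L) (hinj : Function.Injective fun i : Fin (l + 1) => σ^[i] ζ)
    (hF : twistedSeq σ a (l + 1) = 0)
    (hN : ∏ i ∈ Finset.range (l + 1), σ^[i] c = twistedSeq σ a (l + 2)) :
    ∃ x ∈ L, ∃ y ∈ L, ∃ z ∈ L, (σ x * x + x + a = 0 ∧ σ y * y + y + a = 0 ∧
      σ z * z + z + a = 0) ∧ x ≠ y ∧ x ≠ z ∧ y ≠ z := by
  have hH := twistedSeq_succ_ne_zero σ a ha0 hF
  have hG := map_map_twistedSeq σ a (hper a ha) rfl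
  rw [hF] at hG
  simp only [map_zero, mul_zero, zero_add, zero_sub, neg_sub, sub_neg_eq_add] at hG
  have hfix := exists_fixed_not_on_line σ a hL ha hc l.succ_pos (fun v h1 h2 => by
    obtain ⟨e1, e2⟩ := twistStep_iterate_formula σ a ha0 c v l
    rw [hN, hper _ h1, hF, map_zero] at e1
    rw [hN, hper _ h2, hF] at e2
    refine Prod.ext (mul_left_cancel₀ hH ?_) (mul_left_cancel₀ hH ?_)
    · linear_combination e1
    · linear_combination e2 - hG * ((twistStep σ a c)^[l + 1] v).2) hζ hinj
  obtain ⟨v, hv1, hv2, hv, hv0⟩ := hfix 0 1 (Or.inr one_ne_zero)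
  obtain ⟨w, hw1, hw2, hw, hw0⟩ := hfix v.2 (-v.1) (Or.inl (by simpa using hv0))
  have hvz := zero_of_twistStep_fixed σ a ha0 hv (by rintro rfl; simp at hv0)
  have hwz := zero_of_twistStep_fixed σ a ha0 hw (by rintro rfl; simp at hw0)
  have huz := zero_of_twistStep_fixed σ a ha0 (v := v + w) (by rw [map_add, hv, hw]) (by
    intro h
    rw [eq_neg_of_add_eq_zero_right h] at hw0
    exact hw0 (by simp only [Prod.fst_neg, Prod.snd_neg]; ring))
  have hu2 : v.2 + w.2 ≠ 0 := huz.1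
  refine ⟨_, L.div_mem hv1 hv2, _, L.div_mem hw1 hw2, _,
    L.div_mem (L.add_mem hv1 hw1) (L.add_mem hv2 hw2), ⟨hvz.2, hwz.2, huz.2⟩, ?_, ?_, ?_⟩
  · rw [Ne, div_eq_div_iff hvz.1 hwz.1]
    exact fun h => hw0 (by linear_combination -h)
  · rw [Ne, div_eq_div_iff hvz.1 hu2]
    exact fun h => hw0 (by linear_combination -h)
  · rw [Ne, div_eq_div_iff hwz.1 hu2]
    exact fun h => hw0 (by linear_combination h)

end TwistedSequence

section FiniteField

variable {K : Type*} [Field K]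

theorem pow_pow_gcd {p n k : ℕ} {x : K} (hn : x ^ p ^ n = x) (hk : x ^ p ^ k = x) :
    x ^ p ^ n.gcd k = x := by
  have h : ∀ j, Function.IsPeriodicPt (fun y : K => y ^ p) j x ↔ x ^ p ^ j = x := fun j => by
    rw [Function.IsPeriodicPt, Function.IsFixedPt, pow_iterate]
  exact (h _).1 (((h n).2 hn).gcd ((h k).2 hk))

theorem pow_pow_of_dvd {p n k : ℕ} {x : K} (hn : x ^ p ^ n = x) (hnk : n ∣ k) :
    x ^ p ^ k = x := by
  obtain ⟨t, rfl⟩ := hnk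
  induction t with
  | zero => simp
  | succ t ih => rw [mul_add, mul_one, pow_add, pow_mul, ih, hn]

theorem pow_pow_mod {p d m : ℕ} {c : K} (hc : c ^ p ^ (d * m) = c) (j : ℕ) :
    c ^ p ^ (d * j) = c ^ p ^ (d * (j % m)) := by
  conv_lhs => rw [← Nat.div_add_mod j m, mul_add, pow_add, pow_mul]
  rw [pow_pow_of_dvd hc (Dvd.intro (j / m) (by ring))]

/-- Surjectivity of the norm, for the generator `x ↦ x ^ p ^ (d * e)` of the Galois group. -/
theorem exists_prod_pow_eq [IsAlgClosed K] {p d e m : ℕ} (hp : 0 < p) (hm : 0 < m)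
    (he : Nat.Coprime e m) {h : K} (h0 : h ≠ 0) (hh : h ^ p ^ d = h) :
    ∃ c : K, c ^ p ^ (d * m) = c ∧ ∏ i ∈ Finset.range m, c ^ (p ^ (d * e)) ^ i = h := by
  have hpos : 0 < p ^ d := pow_pos hp d
  obtain ⟨s, hs⟩ : ∃ s, p ^ d = s + 1 := ⟨p ^ d - 1, by lia⟩
  have hS : 0 < ∑ i ∈ Finset.range m, (p ^ d) ^ i :=
    Finset.sum_pos (fun i _ => pow_pos hpos i) ⟨0, Finset.mem_range.2 hm⟩
  obtain ⟨c, hc⟩ := IsAlgClosed.exists_pow_nat_eq h hS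
  have hs1 : h ^ s = 1 := by
    rw [hs, pow_succ] at hh
    exact mul_right_cancel₀ h0 (by rw [hh, one_mul])
  have hcm : c ^ p ^ (d * m) = c := by
    rw [pow_mul, hs, ← geom_sum_mul_add, ← hs, pow_succ, pow_mul, hc, hs1, one_mul]
  refine ⟨c, hcm, ?_⟩
  have hmaps : ∀ i ∈ Finset.range m, e * i % m ∈ Finset.range m := fun i _ =>
    Finset.mem_range.2 (Nat.mod_lt _ hm)
  have hinj : Set.InjOn (fun i => e * i % m) (Finset.range m) := by
    intro i hi j hj hij
    have h1 : i ≡ j [MOD m] := Nat.ModEq.cancel_left_of_coprime he.symm hij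
    exact h1.eq_of_lt_of_lt (Finset.mem_range.1 hi) (Finset.mem_range.1 hj)
  rw [← hc, ← Finset.prod_pow_eq_pow_sum]
  refine Finset.prod_nbij (fun i => e * i % m) hmaps hinj
    (Finset.surjOn_of_injOn_of_card_le _ hmaps hinj le_rfl) fun i _ => ?_
  rw [← pow_mul, ← pow_mul, mul_assoc, pow_pow_mod hcm]

theorem exists_injective_pow [IsAlgClosed K] {p d e m : ℕ} [Fact p.Prime] [CharP K p]
    (hd : 0 < d) (hm : 0 < m) (he : Nat.Coprime e m) :
    ∃ ζ : K, ζ ^ p ^ (d * m) = ζ ∧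
      Function.Injective fun i : Fin m => ζ ^ (p ^ (d * e)) ^ (i : ℕ) := by
  have hp := (Fact.out : p.Prime)
  have hpos : 0 < p ^ (d * m) := pow_pos hp.pos _
  have hdm : 0 < d * m := Nat.mul_pos hd hm
  have : NeZero ((p ^ (d * m) - 1 : ℕ) : K) := ⟨by
    rw [Nat.cast_sub hpos]
    simp [hdm.ne']⟩
  obtain ⟨ζ, hζ⟩ := HasEnoughRootsOfUnity.exists_primitiveRoot K (p ^ (d * m) - 1)
  have hζm : ζ ^ p ^ (d * m) = ζ := by
    conv_lhs => rw [← Nat.sub_add_cancel (Nat.one_le_of_lt hpos), pow_succ, hζ.pow_eq_one, one_mul]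
  have hζ0 : ζ ≠ 0 := hζ.ne_zero (by
    have := Nat.one_lt_pow hdm.ne' hp.one_lt
    lia)
  have key : ∀ i j : ℕ, i < j → j < m →
      ζ ^ (p ^ (d * e)) ^ i ≠ ζ ^ (p ^ (d * e)) ^ j := by
    intro i j hij hjm h
    obtain ⟨t, rfl⟩ := Nat.exists_eq_add_of_lt hij
    rw [show i + t + 1 = (t + 1) + i by ring, pow_add, pow_mul ζ, ← pow_mul p (d * e) i] at h
    have h1 : ζ = ζ ^ (p ^ (d * e)) ^ (t + 1) :=
      iterateFrobenius_inj K p (d * e * i) (by simpa only [iterateFrobenius_def] using h)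
    rw [← pow_mul] at h1
    have h2 := pow_pow_gcd hζm h1.symm
    set g := (d * m).gcd (d * e * (t + 1)) with hg
    have hgpos : 0 < p ^ g := pow_pos hp.pos _
    have hg0 : 0 < g := Nat.gcd_pos_of_pos_left _ hdm
    have h3 : p ^ (d * m) - 1 ∣ p ^ g - 1 := by
      refine hζ.dvd_of_pow_eq_one _ (mul_right_cancel₀ hζ0 ?_)
      rw [← pow_succ, Nat.sub_add_cancel hgpos, h2, one_mul]
    have h4 := Nat.le_of_dvd (by
      have := Nat.one_lt_pow hg0.ne' hp.one_lt
      lia) h3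
    have h5 : d * m ≤ g := (Nat.pow_le_pow_iff_right hp.one_lt).1 (by lia)
    have h6 : g = d * m := le_antisymm (Nat.le_of_dvd hdm (Nat.gcd_dvd_left _ _)) h5
    have h7 : d * m ∣ d * (e * (t + 1)) := by
      rw [← mul_assoc]
      exact h6 ▸ Nat.gcd_dvd_right _ _
    have h8 := Nat.le_of_dvd t.succ_pos
      (he.symm.dvd_of_dvd_mul_left (Nat.dvd_of_mul_dvd_mul_left hd h7))
    lia
  refine ⟨ζ, hζm, fun i j hij => ?_⟩
  rcases lt_trichotomy i j with h | h | h
  · exact absurd hij (key i j h j.2)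
  · exact h
  · exact absurd hij.symm (key j i h i.2)

theorem iterate_iterateFrobenius {p k : ℕ} [ExpChar K p] (i : ℕ) (x : K) :
    (iterateFrobenius K p k)^[i] x = x ^ (p ^ k) ^ i := by
  have h : ⇑(iterateFrobenius K p k) = fun y => y ^ p ^ k :=
    funext (iterateFrobenius_def p k)
  rw [h, pow_iterate]

theorem aeval_eq_twistedSeq {p k : ℕ} [Fact p.Prime] [CharP K p] [Algebra (ZMod p) K]
    {A : ℕ → (ZMod p)[X]} (hA1 : A 1 = 1) (hA2 : A 2 = -1)
    (hA : ∀ r : ℕ, 1 ≤ r → A (r + 2) = -(A (r + 1)) ^ p ^ k - X ^ p ^ k * A r ^ (p ^ k) ^ 2)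
    (a : K) (r : ℕ) : aeval a (A (r + 1)) = twistedSeq (iterateFrobenius K p k) a (r + 1) := by
  induction r using Nat.twoStepInduction with
  | zero => simp [hA1, twistedSeq]
  | one => simp [hA2, twistedSeq]
  | more r h0 h1 =>
    rw [hA (r + 1) (by lia), twistedSeq_add_two, ← h0, ← h1]
    simp only [map_sub, map_neg, map_mul, map_pow, aeval_X, iterateFrobenius_def, ← pow_mul, sq]

/-- Euler's criterion in the subfield with `s` elements. -/
theorem pow_half_eq_one_iff [IsAlgClosed K] {s : ℕ} (hs : Odd s) (hs1 : 1 < s) (E : K) :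
    E ^ ((s - 1) / 2) = 1 ↔ E ≠ 0 ∧ ∃ r : K, r ^ 2 = E ∧ r ^ s = r := by
  obtain ⟨t, rfl⟩ := hs
  have ht : (2 * t + 1 - 1) / 2 = t := by lia
  rw [ht]
  constructor
  · intro h
    refine ⟨?_, ?_⟩
    · rintro rfl
      rw [zero_pow (by lia)] at h
      exact zero_ne_one h
    · obtain ⟨r, hr⟩ := IsAlgClosed.exists_pow_nat_eq E two_pos
      exact ⟨r, hr, by rw [pow_succ, pow_mul, hr, h, one_mul]⟩
  · rintro ⟨h0, r, rfl, hr⟩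
    have hr0 : r ≠ 0 := by
      rintro rfl
      exact h0 (by simp)
    rw [pow_succ, pow_mul] at hr
    exact mul_right_cancel₀ hr0 (by rw [hr, one_mul])

end FiniteField

theorem stmt_4 (p k n : ℕ) [Fact p.Prime] (hodd : Odd p) (hk : 1 ≤ k) (hn : 1 ≤ n)
    (d m q Q : ℕ) (hd : d = Nat.gcd n k) (hm : m = n / d) (hm2 : 2 ≤ m)
    (hq : q = p ^ k) (hQ : Q = p ^ n)
    (A : ℕ → Polynomial (ZMod p)) (hA1 : A 1 = 1) (hA2 : A 2 = -1)
    (hA : ∀ r : ℕ, 1 ≤ r → A (r + 2) = -(A (r + 1)) ^ q - X ^ q * A r ^ q ^ 2)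
    (a : AlgebraicClosure (ZMod p)) (haQ : a ^ Q = a) (ha0 : a ≠ 0)
    (Fa Ga E : AlgebraicClosure (ZMod p))
    (hFa : Fa = aeval a (A m))
    (hGa : Ga = -(aeval a (A (m + 1))) - a * (aeval a (A (m - 1))) ^ q)
    (hE : E = Ga ^ 2 - 4 * a * Fa ^ (q + 1))
    (Na : ℕ)
    (hNa : Na = {x : AlgebraicClosure (ZMod p) |
      x ^ Q = x ∧ x ^ (q + 1) + x + a = 0}.ncard) :
    (Na = 0 ↔ (E ^ ((p ^ d - 1) / 2) ≠ 0 ∧ E ^ ((p ^ d - 1) / 2) ≠ 1)) ∧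
    ((Na = 1 ↔ (Fa ≠ 0 ∧ E = 0)) ∧
      (Fa ≠ 0 → E = 0 →
        {x : AlgebraicClosure (ZMod p) | x ^ Q = x ∧ x ^ (q + 1) + x + a = 0} =
          {-Ga / (2 * Fa)})) ∧
    ((Na = 2 ↔ E ^ ((p ^ d - 1) / 2) = 1) ∧
      (E ^ ((p ^ d - 1) / 2) = 1 →
        (∃ r : AlgebraicClosure (ZMod p), r ^ 2 = E ∧ r ^ p ^ d = r) ∧
        ∀ r : AlgebraicClosure (ZMod p), r ^ 2 = E → r ^ p ^ d = r →
          {x : AlgebraicClosure (ZMod p) | x ^ Q = x ∧ x ^ (q + 1) + x + a = 0} =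
            {(r - Ga) / (2 * Fa), (-r - Ga) / (2 * Fa)})) := by
  have hp := (Fact.out : p.Prime)
  obtain ⟨l, rfl⟩ : ∃ l, m = l + 1 + 1 := ⟨m - 2, by lia⟩
  have hd0 : 0 < d := hd ▸ Nat.gcd_pos_of_pos_left k hn
  have hnm : n = d * (l + 1 + 1) := by
    rw [hm, Nat.mul_div_cancel' (hd ▸ Nat.gcd_dvd_left n k)]
  obtain ⟨e, hke⟩ : d ∣ k := hd ▸ Nat.gcd_dvd_right n k
  have he : Nat.Coprime e (l + 1 + 1) := by
    have h : d * (l + 1 + 1).gcd e = d * 1 := by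
      rw [← Nat.gcd_mul_left, ← hnm, ← hke, ← hd, mul_one]
    exact Nat.Coprime.symm (Nat.eq_of_mul_eq_mul_left hd0 h)
  have h2 : (2 : AlgebraicClosure (ZMod p)) ≠ 0 := Ring.two_ne_zero (by
    rw [ringChar.eq (AlgebraicClosure (ZMod p)) p]
    rintro rfl
    exact absurd hodd (by decide))
  have hpd : 1 < p ^ d := Nat.one_lt_pow hd0.ne' hp.one_lt
  have hhalf : (p ^ d - 1) / 2 ≠ 0 := by
    obtain ⟨t, ht⟩ := hodd.pow (n := d)
    lia
  have heuler := pow_half_eq_one_iff (K := AlgebraicClosure (ZMod p)) hodd.pow hpd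
  set σ := iterateFrobenius (AlgebraicClosure (ZMod p)) p k with hσ
  have hσq (x : AlgebraicClosure (ZMod p)) : x ^ q = σ x := by rw [hσ, iterateFrobenius_def, hq]
  set L : Subfield (AlgebraicClosure (ZMod p)) :=
    (iterateFrobenius (AlgebraicClosure (ZMod p)) p n).eqLocusField (RingHom.id _)
  have hLmem (x : AlgebraicClosure (ZMod p)) : x ∈ L ↔ x ^ Q = x := by
    rw [hQ, ← iterateFrobenius_def]
    rfl
  have hL (x : AlgebraicClosure (ZMod p)) (hx : x ∈ L) : σ x ∈ L := by
    rw [← hσq]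
    exact pow_mem hx q
  have haL : a ∈ L := (hLmem a).2 haQ
  have hper (x : AlgebraicClosure (ZMod p)) (hx : x ∈ L) : σ^[l + 1 + 1] x = x := by
    rw [hLmem, hQ] at hx
    rw [hσ, iterate_iterateFrobenius, ← pow_mul]
    exact pow_pow_of_dvd hx ⟨e, by rw [hnm, hke]; ring⟩
  have hfixed (x : AlgebraicClosure (ZMod p)) (hx : x ∈ L) (hσx : σ x = x) : x ^ p ^ d = x := by
    rw [hLmem, hQ] at hx
    rw [← hσq, hq] at hσx
    exact hd ▸ pow_pow_gcd hx hσx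
  have hmemL (x : AlgebraicClosure (ZMod p)) (hx : x ^ p ^ d = x) : x ∈ L ∧ σ x = x := by
    rw [hLmem, ← hσq, hQ, hq]
    exact ⟨pow_pow_of_dvd hx ⟨_, hnm⟩, pow_pow_of_dvd hx ⟨_, hke⟩⟩
  subst hq
  have hA' := aeval_eq_twistedSeq (K := AlgebraicClosure (ZMod p)) hA1 hA2 hA a
  rw [← hσ] at hA'
  rw [hA'] at hFa
  rw [Nat.add_sub_cancel, hA', hA', hσq] at hGa
  have hFL : Fa ∈ L := hFa ▸ twistedSeq_mem σ a hL haL _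
  have hGL : Ga ∈ L := by
    rw [hGa]
    exact L.sub_mem (L.neg_mem (twistedSeq_mem σ a hL haL _))
      (L.mul_mem haL (hL _ (twistedSeq_mem σ a hL haL _)))
  rw [pow_succ Fa, hσq, mul_comm (σ Fa)] at hE
  set S : Set (AlgebraicClosure (ZMod p)) := {x | x ^ Q = x ∧ x ^ (p ^ k + 1) + x + a = 0}
  have hSmem (x : AlgebraicClosure (ZMod p)) : x ∈ S ↔ x ∈ L ∧ σ x * x + x + a = 0 := by
    rw [hLmem, ← hσq, ← pow_succ]
    rfl
  by_cases hF0 : Fa = 0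
  · have hG0 : Ga = 0 := by
      have h := map_map_twistedSeq σ a (hper a haL) hGa
      rw [← hFa, hF0] at h
      simpa using h
    have hE0 : E = 0 := by rw [hE, hF0, hG0]; simp
    have hcard : 2 < Na := by
      have hb := twistedSeq_succ_ne_zero σ a ha0 (hFa.symm.trans hF0)
      have hσb : σ (twistedSeq σ a (l + 1 + 1 + 1)) = twistedSeq σ a (l + 1 + 1 + 1) := by
        have h1 := congrArg σ (twistedSeq_add_two_linear σ a (l + 1))
        simp only [map_sub, map_neg, map_mul, ← Function.iterate_succ_apply',
          Nat.succ_eq_add_one, hper a haL, ← hFa, hF0, map_zero] at h1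
        rw [hG0] at hGa
        linear_combination h1 - hGa
      obtain ⟨c, hcL, hc⟩ := exists_prod_pow_eq hp.pos (Nat.succ_pos (l + 1)) he hb
        (hfixed _ (twistedSeq_mem σ a hL haL _) hσb)
      obtain ⟨ζ, hζL, hζ⟩ :=
        exists_injective_pow (K := AlgebraicClosure (ZMod p)) (p := p) hd0 (Nat.succ_pos (l + 1)) he
      rw [← hke] at hc hζ
      simp only [Nat.succ_eq_add_one, ← hnm, ← hQ, ← hLmem] at hcL hζL
      simp only [← iterate_iterateFrobenius] at hc hζ
      obtain ⟨x, hx, y, hy, z, hz, ⟨h1, h2, h3⟩, hne⟩ :=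
        three_zeros σ a hL haL ha0 hcL hper hζL hζ (hFa.symm.trans hF0) hc
      have hfin : S.Finite := by
        have hQ1 : 1 < Q := hQ ▸ Nat.one_lt_pow (by lia) hp.one_lt
        refine Set.Finite.subset
          ((X ^ Q - X : (ZMod p)[X]).rootSet_finite (AlgebraicClosure (ZMod p))) fun x hx => ?_
        rw [mem_rootSet]
        exact ⟨FiniteField.X_pow_card_sub_X_ne_zero (ZMod p) hQ1, by simp [hx.1]⟩
      rw [hNa]
      exact (Set.two_lt_ncard hfin).2 ⟨x, (hSmem x).2 ⟨hx, h1⟩, y, (hSmem y).2 ⟨hy, h2⟩,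
        z, (hSmem z).2 ⟨hz, h3⟩, hne⟩
    rw [hE0, zero_pow hhalf]
    refine ⟨⟨by lia, fun h => absurd rfl h.1⟩, ⟨⟨by lia, fun h => absurd hF0 h.1⟩,
      fun h => absurd hF0 h⟩, ⟨by lia, fun h => absurd h zero_ne_one⟩,
      fun h => absurd h zero_ne_one⟩
  · have hroots (r : AlgebraicClosure (ZMod p)) (hr : r ^ 2 = E) (hrd : r ^ p ^ d = r) :
        S = {(r - Ga) / (2 * Fa), (-r - Ga) / (2 * Fa)} := by
      have h2F : 2 * Fa ≠ 0 := mul_ne_zero h2 hF0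
      have h2L : (2 : AlgebraicClosure (ZMod p)) ∈ L := ofNat_mem L 2
      have hback (r : AlgebraicClosure (ZMod p)) (hr : r ^ 2 = E) (hrL : r ∈ L) (hσr : σ r = r) :
          (r - Ga) / (2 * Fa) ∈ S :=
        (hSmem _).2 ⟨L.div_mem (L.sub_mem hrL hGL) (L.mul_mem h2L hFL),
          zero_of_sq σ a (hper a haL) h2 hFa hGa hF0 (hr.trans hE) hσr⟩
      obtain ⟨hrL, hσr⟩ := hmemL r hrd
      ext x
      rw [Set.mem_insert_iff, Set.mem_singleton_iff]
      constructor
      · intro hx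
        rw [hSmem] at hx
        have h := (sq_and_map_of_zero σ a (hper a haL) ha0 hFa hGa hx.2 (hper x hx.1)).1
        rw [← hE, ← hr, sq_eq_sq_iff_eq_or_eq_neg] at h
        rw [eq_div_iff h2F, eq_div_iff h2F]
        exact h.imp (fun h => by linear_combination h) fun h => by linear_combination h
      · rintro (rfl | rfl)
        · exact hback r hr hrL hσr
        · exact hback (-r) (by rw [neg_sq, hr]) (L.neg_mem hrL) (by rw [map_neg, hσr])
    have hzero (hE0 : E = 0) : S = {-Ga / (2 * Fa)} := by
      rw [hroots 0 (by rw [hE0]; simp) (zero_pow (by lia))]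
      simp
    have htwo (h1 : E ^ ((p ^ d - 1) / 2) = 1) : Na = 2 := by
      obtain ⟨hE0, r, hr, hrd⟩ := (heuler E).1 h1
      have hr0 : r ≠ 0 := by
        rintro rfl
        exact hE0 (by rw [← hr]; simp)
      rw [hNa, hroots r hr hrd, Set.ncard_pair]
      rw [Ne, div_left_inj' (mul_ne_zero h2 hF0)]
      intro h
      exact mul_ne_zero h2 hr0 (by linear_combination h)
    have hnone (hE0 : E ≠ 0) (h1 : E ^ ((p ^ d - 1) / 2) ≠ 1) : Na = 0 := by
      have hempty : S = ∅ := by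
        refine Set.eq_empty_iff_forall_notMem.2 fun x hx => h1 ((heuler E).2 ⟨hE0, ?_⟩)
        rw [hSmem] at hx
        obtain ⟨hsq, hσx⟩ := sq_and_map_of_zero σ a (hper a haL) ha0 hFa hGa hx.2 (hper x hx.1)
        exact ⟨_, hsq.trans hE.symm, hfixed _
          (L.add_mem (L.mul_mem (L.mul_mem (ofNat_mem L 2) hFL) hx.1) hGL) hσx⟩
      rw [hNa, hempty, Set.ncard_empty]
    have hone (hE0 : E = 0) : Na = 1 := by rw [hNa, hzero hE0, Set.ncard_singleton]
    have hiff : E ^ ((p ^ d - 1) / 2) ≠ 0 ↔ E ≠ 0 := by rw [Ne, pow_eq_zero_iff hhalf]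
    have hE1 (h1 : E ^ ((p ^ d - 1) / 2) = 1) : E ≠ 0 := ((heuler E).1 h1).1
    rw [hiff]
    refine ⟨?_, ⟨?_, fun _ => hzero⟩, ?_, fun h1 => ⟨((heuler E).1 h1).2, hroots⟩⟩
    all_goals
      by_cases hE0 : E = 0
      · have := hone hE0
        grind
      · by_cases h1 : E ^ ((p ^ d - 1) / 2) = 1
        · have := htwo h1
          grind
        · have := hnone hE0 h1
          grind
end

section
/- Assume p = 2 and let a ∈ GF(Q)*. Then G(a) ∈ GF(2^d); when G(a) ≠ 0 set H = Tr_{GF(2^d)/GF(2)}( Nr_{GF(2^n)/GF(2^d)}(a) / G(a)^2 ) and E = a·F(a)^{q+1}/G(a)^2. Then: (1) N_a = 0 if and only if G(a) ≠ 0 and H ≠ 0; (2) N_a = 1 if and only if F(a) ≠ 0 and G(a) = 0, and in this case the unique zero of P_a(X) in GF(Q) is the unique square root of a·F(a)^{q-1} in GF(Q); (3) N_a = 2 if and only if G(a) ≠ 0 and H = 0, and in this case, for any ζ ≠ 1 in the algebraic closure of GF(2) with ζ^{Q+1} = 1, the two zeros of P_a(X) in GF(Q) are x_1 = (G(a)/F(a))·T_n(E/(ζ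 + 1)) and x_2 = x_1 + G(a)/F(a), where T_n(x) = Σ_{i=0}^{n-1} x^{2^i}. -/
open Polynomial

section

variable {K : Type*} [Field K]

theorem map_shiftRec (σ τ : K →+* K) (hστ : ∀ x, τ (σ x) = σ (τ x)) (a : K) (ha : τ a = a)
    (f : ℕ → K) (h0 : f 0 = 0) (h1 : f 1 = 1)
    (hf : ∀ r, f (r + 2) = σ (f (r + 1)) + σ a * σ (σ (f r))) (r : ℕ) : τ (f r) = f r := by
  induction r using Nat.twoStepInduction with
  | zero => simp [h0]
  | one => simp [h1]
  | more r ih1 ih2 => simp [hf, hστ, ha, ih1, ih2]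

/-- The semilinear map whose fixed lines are the zeros of `x ^ (q + 1) + x + c ^ 2`. -/
def twist (σ : K →+* K) (c : K) (v : K × K) : K × K :=
  (c * σ v.2, (σ v.1 + σ v.2) / c)

theorem twist_add (σ : K →+* K) (c : K) (v w : K × K) :
    twist σ c (v + w) = twist σ c v + twist σ c w := by
  ext <;> simp [twist] <;> ring

theorem twist_sum (σ : K →+* K) (c : K) (w : ℕ → K × K) (m : ℕ) :
    twist σ c (∑ i ∈ Finset.range m, w i) = ∑ i ∈ Finset.range m, twist σ c (w i) := by
  induction m with
  | zero => simp [twist]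
  | succ m ih => rw [Finset.sum_range_succ, Finset.sum_range_succ, twist_add, ih]

theorem twist_iterate_smul (σ : K →+* K) (c l : K) (v : K × K) (i : ℕ) :
    (twist σ c)^[i] (l • v) = σ^[i] l • (twist σ c)^[i] v := by
  induction i with
  | zero => rfl
  | succ i ih =>
    simp only [Function.iterate_succ_apply', ih]
    ext <;> simp [twist] <;> ring

theorem map_twist_iterate (σ τ : K →+* K) (hστ : ∀ x, τ (σ x) = σ (τ x)) (c : K) (hc : τ c = c)
    (v : K × K) (h1 : τ v.1 = v.1) (h2 : τ v.2 = v.2) (i : ℕ) :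
    τ ((twist σ c)^[i] v).1 = ((twist σ c)^[i] v).1 ∧
      τ ((twist σ c)^[i] v).2 = ((twist σ c)^[i] v).2 := by
  induction i with
  | zero => exact ⟨h1, h2⟩
  | succ i ih =>
    simp only [Function.iterate_succ_apply']
    simp [twist, hστ, hc, ih.1, ih.2]

theorem twist_iterate (σ : K →+* K) (a c : K) (hc : c ≠ 0) (hca : c ^ 2 = a)
    (f : ℕ → K) (h0 : f 0 = 0) (h1 : f 1 = 1)
    (hf : ∀ r, f (r + 2) = σ (f (r + 1)) + σ a * σ (σ (f r))) (v : K × K) (r : ℕ) :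
    (∏ i ∈ Finset.range (r + 1), σ^[i] c) * ((twist σ c)^[r + 1] v).1 =
        a * σ (f r) * σ^[r + 1] v.1 + a * σ (f (r + 1)) * σ^[r + 1] v.2 ∧
      (∏ i ∈ Finset.range (r + 1), σ^[i] c) * ((twist σ c)^[r + 1] v).2 =
        f (r + 1) * σ^[r + 1] v.1 + f (r + 2) * σ^[r + 1] v.2 := by
  induction r with
  | zero => simp [twist, h0, h1, hf, ← hca]; constructor <;> field_simp
  | succ r ih =>
    obtain ⟨e1, e2⟩ := ih
    replace e1 := congrArg σ e1
    replace e2 := congrArg σ e2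
    simp only [map_add, map_mul, map_prod, ← Function.iterate_succ_apply' σ] at e1 e2
    rw [Finset.prod_range_succ', Function.iterate_succ_apply' (twist σ c)]
    simp only [Function.iterate_zero, id, twist]
    have hdiv : c * ((σ ((twist σ c)^[r + 1] v).1 + σ ((twist σ c)^[r + 1] v).2) / c) =
        σ ((twist σ c)^[r + 1] v).1 + σ ((twist σ c)^[r + 1] v).2 := by field_simp
    simp only [Nat.succ_eq_add_one] at *
    constructor
    · linear_combination a * e2 +
        (∏ i ∈ Finset.range (r + 1), σ^[i + 1] c) * σ ((twist σ c)^[r + 1] v).2 * hca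
    · rw [mul_assoc, hdiv]
      linear_combination e1 + e2 - σ^[r + 1 + 1] v.1 * hf r - σ^[r + 1 + 1] v.2 * hf (r + 1)

theorem finite_zeros {a : K} (q Q : ℕ) (hq : 2 ≤ q) :
    {x : K | x ^ Q = x ∧ x ^ (q + 1) + x + a = 0}.Finite := by
  have hp : (X ^ (q + 1) + X + C a : K[X]) ≠ 0 := by
    intro h
    have := congrArg (fun P => Polynomial.coeff P (q + 1)) h
    simp [coeff_X, show q ≠ 0 by omega] at this
  refine (Polynomial.finite_setOfPred_isRoot hp).subset fun x hx => ?_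
  simpa [IsRoot] using hx.2

theorem exists_fixed_twist (σ τ : K →+* K) (hστ : ∀ x, τ (σ x) = σ (τ x)) (c : K) (hc : τ c = c)
    (m : ℕ)
    (hper : ∀ v : K × K, τ v.1 = v.1 → τ v.2 = v.2 → (twist σ c)^[m] v = v)
    (hind : ∀ g : ℕ → K, (∀ l, τ l = l → ∑ i ∈ Finset.range m, σ^[i] l * g i = 0) → g 0 = 0)
    (b₁ b₂ : K) (hb : b₁ ≠ 0 ∨ b₂ ≠ 0) :
    ∃ w : K × K, τ w.1 = w.1 ∧ τ w.2 = w.2 ∧ twist σ c w = w ∧ b₁ * w.1 + b₂ * w.2 ≠ 0 := by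
  obtain ⟨v, hv1, hv2, hv⟩ : ∃ v : K × K, τ v.1 = v.1 ∧ τ v.2 = v.2 ∧
      b₁ * v.1 + b₂ * v.2 ≠ 0 := by
    rcases hb with hb | hb
    · exact ⟨(1, 0), by simp [hb]⟩
    · exact ⟨(0, 1), by simp [hb]⟩
  by_contra! hno
  apply hv
  refine hind (fun i => b₁ * ((twist σ c)^[i] v).1 + b₂ * ((twist σ c)^[i] v).2) fun l hl => ?_
  have hl1 : τ (l • v).1 = (l • v).1 := by simp [hl, hv1]
  have hl2 : τ (l • v).2 = (l • v).2 := by simp [hl, hv2]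
  have key := hno (∑ i ∈ Finset.range m, (twist σ c)^[i] (l • v)) ?_ ?_ ?_
  · rw [← key, Prod.fst_sum, Prod.snd_sum, Finset.mul_sum, Finset.mul_sum,
      ← Finset.sum_add_distrib]
    refine Finset.sum_congr rfl fun i _ => ?_
    rw [twist_iterate_smul]
    simp only [Prod.smul_fst, Prod.smul_snd, smul_eq_mul]
    ring
  · rw [Prod.fst_sum, map_sum]
    exact Finset.sum_congr rfl fun i _ => (map_twist_iterate σ τ hστ c hc _ hl1 hl2 i).1
  · rw [Prod.snd_sum, map_sum]
    exact Finset.sum_congr rfl fun i _ => (map_twist_iterate σ τ hστ c hc _ hl1 hl2 i).2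
  · rw [twist_sum]
    simp only [← Function.iterate_succ_apply' (twist σ c)]
    have e1 := Finset.sum_range_succ (fun i => (twist σ c)^[i] (l • v)) m
    rw [Finset.sum_range_succ', hper _ hl1 hl2] at e1
    exact add_right_cancel e1

variable [CharP K 2]

theorem shiftRec_left (σ : K →+* K) (a : K) (f : ℕ → K) (h0 : f 0 = 0) (h1 : f 1 = 1)
    (hf : ∀ r, f (r + 2) = σ (f (r + 1)) + σ a * σ (σ (f r))) (r : ℕ) :
    f (r + 2) = f (r + 1) + σ^[r] a * f r := by
  induction r using Nat.twoStepInduction with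
  | zero => simp [hf, h0, h1]
  | one => simp [hf, h0, h1]
  | more r ih1 ih2 =>
    have e1 := congrArg (fun z => σ (σ z)) ih1
    have e2 := congrArg σ ih2
    have e3 := hf (r + 1)
    have e4 := hf (r + 2)
    simp only [map_add, map_mul, ← Function.iterate_succ_apply' σ] at e1 e2
    rw [e4, e2, e1, e3]
    have e5 := hf r
    simp only [Nat.succ_eq_add_one] at *
    grind

theorem det_shiftRec (σ : K →+* K) (a : K) (f : ℕ → K) (h0 : f 0 = 0) (h1 : f 1 = 1)
    (hf : ∀ r, f (r + 2) = σ (f (r + 1)) + σ a * σ (σ (f r))) (r : ℕ) :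
    f (r + 2) * (a * σ (f r)) + a * f (r + 1) * σ (f (r + 1)) =
      ∏ i ∈ Finset.range (r + 1), σ^[i] a := by
  induction r with
  | zero => simp [h0, h1]
  | succ r ih =>
    have e1 := congrArg σ ih
    rw [Finset.prod_range_succ']
    simp only [map_add, map_mul, map_prod, ← Function.iterate_succ_apply' σ] at e1
    simp only [Function.iterate_zero, id]
    rw [← e1, hf (r + 1)]
    have := hf r
    grind

theorem root_iterate (σ : K →+* K) (a : K) (f : ℕ → K) (h0 : f 0 = 0) (h1 : f 1 = 1)
    (hf : ∀ r, f (r + 2) = σ (f (r + 1)) + σ a * σ (σ (f r))) (x : K)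
    (hx : σ x * x + x + a = 0) (r : ℕ) :
    σ^[r + 1] x * (f (r + 1) * x + a * σ (f r)) = f (r + 2) * x + a * σ (f (r + 1)) := by
  induction r with
  | zero => simp [h0, h1, hf]; grind
  | succ r ih =>
    have e1 := congrArg σ ih
    simp only [map_add, map_mul, ← Function.iterate_succ_apply' σ] at e1
    have e2 := hf r
    have e3 := hf (r + 1)
    rw [e3]
    simp only [Nat.succ_eq_add_one] at *
    grind

theorem root_of_fixed_twist (σ τ : K →+* K) (c : K) (hc0 : c ≠ 0) (w : K × K)
    (h1 : τ w.1 = w.1) (h2 : τ w.2 = w.2) (hw : twist σ c w = w) (hw0 : w ≠ 0) :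
    w.2 ≠ 0 ∧ τ (w.1 / w.2) = w.1 / w.2 ∧
      σ (w.1 / w.2) * (w.1 / w.2) + w.1 / w.2 + c ^ 2 = 0 := by
  obtain ⟨s, t⟩ := w
  simp only [twist, Prod.mk.injEq] at h1 h2 hw ⊢
  obtain ⟨hs, ht⟩ := hw
  have ht0 : t ≠ 0 := by
    rintro rfl
    apply hw0
    simp only [map_zero, mul_zero] at hs
    simp [← hs]
  have hσt : σ t ≠ 0 := by simpa using ht0
  refine ⟨ht0, by simp [h1, h2], ?_⟩
  rw [div_eq_iff hc0] at ht
  rw [map_div₀]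
  field_simp
  grind

theorem exists_three_roots (σ τ : K →+* K) (hστ : ∀ x, τ (σ x) = σ (τ x)) (c : K) (hc : τ c = c)
    (hc0 : c ≠ 0) (m : ℕ)
    (hper : ∀ v : K × K, τ v.1 = v.1 → τ v.2 = v.2 → (twist σ c)^[m] v = v)
    (hind : ∀ g : ℕ → K, (∀ l, τ l = l → ∑ i ∈ Finset.range m, σ^[i] l * g i = 0) → g 0 = 0) :
    ∃ x y z : K, (τ x = x ∧ σ x * x + x + c ^ 2 = 0) ∧ (τ y = y ∧ σ y * y + y + c ^ 2 = 0) ∧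
      (τ z = z ∧ σ z * z + z + c ^ 2 = 0) ∧ x ≠ y ∧ x ≠ z ∧ y ≠ z := by
  obtain ⟨v, hv1, hv2, hv, hv0⟩ :=
    exists_fixed_twist σ τ hστ c hc m hper hind 1 0 (Or.inl one_ne_zero)
  have hvne : v ≠ 0 := by rintro rfl; simp at hv0
  obtain ⟨hv3, hv4⟩ := root_of_fixed_twist σ τ c hc0 v hv1 hv2 hv hvne
  obtain ⟨w, hw1, hw2, hw, hw0⟩ :=
    exists_fixed_twist σ τ hστ c hc m hper hind v.2 v.1 (Or.inl hv3)
  have hwne : w ≠ 0 := by rintro rfl; simp at hw0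
  obtain ⟨hw3, hw4⟩ := root_of_fixed_twist σ τ c hc0 w hw1 hw2 hw hwne
  have hne : v + w ≠ 0 := by
    intro h
    have e1 : v.1 + w.1 = 0 := congrArg Prod.fst h
    have e2 : v.2 + w.2 = 0 := congrArg Prod.snd h
    grind
  obtain ⟨hu3, hu4⟩ := root_of_fixed_twist σ τ c hc0 (v + w) (by simp [hv1, hw1])
    (by simp [hv2, hw2]) (by rw [twist_add, hv, hw]) hne
  refine ⟨_, _, _, hv4, hw4, hu4, ?_, ?_, ?_⟩
  · rw [Ne, div_eq_div_iff hv3 hw3]; grind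
  · rw [Ne, div_eq_div_iff hv3 hu3, Prod.fst_add, Prod.snd_add]; grind
  · rw [Ne, div_eq_div_iff hw3 hu3, Prod.fst_add, Prod.snd_add]; grind

theorem isPeriodicPt_frobenius_iff (x : K) (n : ℕ) :
    Function.IsPeriodicPt (frobenius K 2) n x ↔ x ^ 2 ^ n = x := by
  rw [Function.IsPeriodicPt, Function.IsFixedPt, ← coe_iterateFrobenius, iterateFrobenius_def]

theorem pow_two_pow_gcd {x : K} {n k : ℕ} (hn : x ^ 2 ^ n = x) (hk : x ^ 2 ^ k = x) :
    x ^ 2 ^ Nat.gcd n k = x := by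
  rw [← isPeriodicPt_frobenius_iff] at *
  exact hn.gcd hk

theorem pow_two_pow_of_dvd {x : K} {d n : ℕ} (hd : x ^ 2 ^ d = x) (hdn : d ∣ n) :
    x ^ 2 ^ n = x := by
  rw [← isPeriodicPt_frobenius_iff] at *
  exact hd.trans_dvd hdn

theorem sum_sq_add_self_pow (u : K) (d : ℕ) :
    ∑ i ∈ Finset.range d, (u ^ 2 + u) ^ 2 ^ i = u ^ 2 ^ d + u := by
  induction d with
  | zero => simp [CharTwo.add_self_eq_zero]
  | succ d ih =>
    rw [Finset.sum_range_succ, ih, add_pow_char_pow]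
    have : (u ^ 2) ^ 2 ^ d = u ^ 2 ^ (d + 1) := by rw [← pow_mul, pow_succ']
    rw [this]
    grind

theorem sum_pow_sq_add_self (w : K) (n : ℕ) :
    (∑ i ∈ Finset.range n, w ^ 2 ^ i) ^ 2 + ∑ i ∈ Finset.range n, w ^ 2 ^ i = w ^ 2 ^ n + w := by
  rw [← sum_sq_add_self_pow, CharTwo.sum_sq, ← Finset.sum_add_distrib]
  refine Finset.sum_congr rfl fun i _ => ?_
  rw [add_pow_char_pow, pow_right_comm]

theorem prod_conjugates {n k d m : ℕ} (hd0 : 0 < d) (hd : d = Nat.gcd n k) (hnm : n = d * m)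
    (hm : 0 < m) {x : K} (hx : x ^ 2 ^ n = x) :
    ∏ i ∈ Finset.range m, x ^ 2 ^ (k * i) = x ^ ((2 ^ n - 1) / (2 ^ d - 1)) := by
  obtain ⟨k', rfl⟩ : d ∣ k := hd ▸ Nat.gcd_dvd_right n k
  have hcop : Nat.Coprime m k' := by
    rw [hnm, Nat.gcd_mul_left] at hd
    exact Nat.eq_of_mul_eq_mul_left hd0 (by rw [← hd, mul_one])
  have h2d : 2 ≤ 2 ^ d := Nat.le_self_pow hd0.ne' 2
  rw [hnm, pow_mul, ← Nat.geomSum_eq h2d, ← Finset.prod_pow_eq_pow_sum]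
  have hmaps : ∀ i ∈ Finset.range m, k' * i % m ∈ Finset.range m :=
    fun i _ => Finset.mem_range.2 (Nat.mod_lt _ hm)
  have hinj : Set.InjOn (fun i => k' * i % m) (Finset.range m) := by
    intro i hi j hj hij
    have h : k' * i ≡ k' * j [MOD m] := hij
    have h' := Nat.ModEq.cancel_left_of_coprime hcop h
    exact Nat.ModEq.eq_of_lt_of_lt h' (Finset.mem_range.1 hi) (Finset.mem_range.1 hj)
  refine Finset.prod_nbij (fun i => k' * i % m) hmaps hinj
    (Finset.surjOn_of_injOn_of_card_le _ hmaps hinj le_rfl) fun i _ => ?_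
  have hdm : d * k' * i = d * m * (k' * i / m) + d * (k' * i % m) := by
    conv_lhs => rw [mul_assoc, ← Nat.div_add_mod (k' * i) m]
    ring
  have hper : x ^ 2 ^ (d * m * (k' * i / m)) = x :=
    pow_two_pow_of_dvd hx (hnm ▸ Dvd.intro _ rfl)
  rw [← pow_mul, hdm, pow_add, pow_mul, hper]

theorem dvd_of_forall_pow_eq [IsAlgClosed K] {n e : ℕ} (hn : 0 < n)
    (h : ∀ x : K, x ^ 2 ^ n = x → x ^ 2 ^ e = x) : n ∣ e := by
  have h2n : 2 ≤ 2 ^ n := Nat.le_self_pow hn.ne' 2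
  have hcast : ((2 ^ n - 1 : ℕ) : K) ≠ 0 := by
    rw [Nat.cast_sub (by omega)]
    simp [CharTwo.two_eq_zero, hn.ne']
  have : NeZero ((2 ^ n - 1 : ℕ) : K) := ⟨hcast⟩
  obtain ⟨ζ, hζ⟩ := HasEnoughRootsOfUnity.exists_primitiveRoot K (2 ^ n - 1)
  have hζn : ζ ^ 2 ^ n = ζ := by
    rw [show 2 ^ n = 2 ^ n - 1 + 1 by omega, pow_succ, hζ.pow_eq_one, one_mul]
  have hg := pow_two_pow_gcd hζn (h ζ hζn)
  have hgpos : 0 < Nat.gcd n e := Nat.gcd_pos_of_pos_left e hn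
  have h2g : 2 ≤ 2 ^ Nat.gcd n e := Nat.le_self_pow hgpos.ne' 2
  have hone : ζ ^ (2 ^ Nat.gcd n e - 1) = 1 := by
    have hζ0 : ζ ≠ 0 := hζ.ne_zero (by omega)
    apply mul_right_cancel₀ hζ0
    rw [← pow_succ, Nat.sub_add_cancel (by omega), hg, one_mul]
  have hle := Nat.le_of_dvd (by omega) (hζ.dvd_of_pow_eq_one _ hone)
  have hle' : n ≤ Nat.gcd n e := (Nat.pow_le_pow_iff_right (a := 2) (by norm_num)).1 (by omega)
  have := Nat.le_antisymm (Nat.le_of_dvd hn (Nat.gcd_dvd_left n e)) hle'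
  exact this ▸ Nat.gcd_dvd_right n e

theorem coeff_zero_of_sum_frobenius [IsAlgClosed K] {n k m : ℕ} (hn : 0 < n) (hm : 0 < m)
    (hdvd : ∀ i, n ∣ k * i → m ∣ i) (g : ℕ → K)
    (h : ∀ l : K, l ^ 2 ^ n = l → ∑ i ∈ Finset.range m, l ^ 2 ^ (k * i) * g i = 0) : g 0 = 0 := by
  let S : Submonoid K :=
    { carrier := {x | x ^ 2 ^ n = x}
      one_mem' := one_pow _
      mul_mem' := fun {x y} (hx : _ = _) (hy : _ = _) => by
        change (x * y) ^ _ = _; rw [mul_pow, hx, hy] }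
  let χ : Fin m → (S →* K) := fun i => (powMonoidHom (2 ^ (k * i.val))).comp S.subtype
  have key : ∀ i j : Fin m, i.val ≤ j.val → χ i = χ j → i = j := by
    intro i j hij hχ
    have hd : n ∣ k * (j.val - i.val) := by
      refine dvd_of_forall_pow_eq (K := K) hn fun x hx => ?_
      have e : x ^ 2 ^ (k * i.val) = x ^ 2 ^ (k * j.val) := DFunLike.congr_fun hχ ⟨x, hx⟩
      apply (iterateFrobenius K 2 (k * i.val)).injective
      rw [iterateFrobenius_def, iterateFrobenius_def, e, ← pow_mul, ← pow_add, ← mul_add,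
        Nat.sub_add_cancel hij]
    have := Nat.eq_zero_of_dvd_of_lt (hdvd _ hd) (by omega)
    exact Fin.ext (by omega)
  have hχ : Function.Injective χ := fun i j hij => by
    rcases le_total i.val j.val with hle | hle
    · exact key i j hle hij
    · exact (key j i hle hij.symm).symm
  have hli := (linearIndependent_monoidHom S K).comp χ hχ
  rw [Fintype.linearIndependent_iff] at hli
  refine hli (fun i => g i) ?_ ⟨0, hm⟩
  ext ⟨l, hl⟩
  have := h l hl
  rw [Finset.sum_range] at this
  simp only [Finset.sum_apply, Pi.smul_apply, smul_eq_mul, Function.comp, Pi.zero_apply]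
  rw [← this]
  exact Finset.sum_congr rfl fun i _ => mul_comm _ _

theorem map_eigenvalue_of_root (σ : K →+* K) {a F α g x : K} (ha : a ≠ 0)
    (h3 : α = σ F + σ a * σ g) (hx : σ x * x + x + a = 0)
    (hquad : F * x ^ 2 + (α + a * g) * x + a * σ F = 0) :
    σ (F * x + a * g) = F * x + a * g := by
  have hx0 : x ≠ 0 := by
    rintro rfl
    simp at hx
    exact ha hx
  apply mul_right_cancel₀ hx0
  simp only [map_add, map_mul]
  grind

theorem root_of_map_eigenvalue (σ τ : K →+* K) {a F α g x : K} (hF : F ≠ 0)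
    (hτa : τ a = a) (hτF : τ F = F) (hτg : τ g = g)
    (h3 : α = σ F + σ a * σ g)
    (hquad : F * x ^ 2 + (α + a * g) * x + a * σ F = 0)
    (hσ : σ (F * x + a * g) = F * x + a * g) (hτ : τ (F * x + a * g) = F * x + a * g) :
    τ x = x ∧ σ x * x + x + a = 0 := by
  have hσF : σ F ≠ 0 := by simpa using hF
  simp only [map_add, map_mul, hτa, hτF, hτg] at hσ hτ
  constructor
  · exact mul_left_cancel₀ hF (add_right_cancel hτ)
  · apply mul_left_cancel₀ hσF
    grind

/-- The zeros of the trinomial are the zeros of a quadratic polynomial at which an associated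
eigenvalue lies in the field with `2 ^ gcd n k` elements. -/
theorem root_iff {n k : ℕ} {a F α g x : K} (ha : a ≠ 0) (hF : F ≠ 0)
    (hτa : a ^ 2 ^ n = a) (hτF : F ^ 2 ^ n = F) (hτg : g ^ 2 ^ n = g)
    (h3 : α = F ^ 2 ^ k + a ^ 2 ^ k * g ^ 2 ^ k)
    (hred : x ^ 2 ^ n = x → x ^ (2 ^ k + 1) + x + a = 0 →
      F * x ^ 2 + (α + a * g) * x + a * F ^ 2 ^ k = 0) :
    (x ^ 2 ^ n = x ∧ x ^ (2 ^ k + 1) + x + a = 0) ↔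
      F * x ^ 2 + (α + a * g) * x + a * F ^ 2 ^ k = 0 ∧
        (F * x + a * g) ^ 2 ^ Nat.gcd n k = F * x + a * g := by
  constructor
  · rintro ⟨hxn, hx⟩
    have hquad := hred hxn hx
    refine ⟨hquad, pow_two_pow_gcd ?_ ?_⟩
    · rw [add_pow_char_pow, mul_pow, mul_pow, hτF, hxn, hτa, hτg]
    · exact map_eigenvalue_of_root (iterateFrobenius K 2 k) ha
        (by simpa only [iterateFrobenius_def] using h3)
        (by simpa only [iterateFrobenius_def, ← pow_succ] using hx)
        (by simpa only [iterateFrobenius_def] using hquad)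
  · rintro ⟨hquad, hl⟩
    have := root_of_map_eigenvalue (iterateFrobenius K 2 k) (iterateFrobenius K 2 n) hF
        (by simpa only [iterateFrobenius_def] using hτa)
        (by simpa only [iterateFrobenius_def] using hτF)
        (by simpa only [iterateFrobenius_def] using hτg)
        (by simpa only [iterateFrobenius_def] using h3)
        (by simpa only [iterateFrobenius_def] using hquad)
        (by
          rw [iterateFrobenius_def]
          exact pow_two_pow_of_dvd hl (Nat.gcd_dvd_right n k))
        (by
          rw [iterateFrobenius_def]
          exact pow_two_pow_of_dvd hl (Nat.gcd_dvd_left n k))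
    simpa only [iterateFrobenius_def, ← pow_succ] using this

theorem sum_pow_eq_zero_iff {G N l : K} {d : ℕ} (hG : G ≠ 0) (hGd : G ^ 2 ^ d = G)
    (hl : l ^ 2 + G * l = N) :
    ∑ i ∈ Finset.range d, (N / G ^ 2) ^ 2 ^ i = 0 ↔ l ^ 2 ^ d = l := by
  have hu : N / G ^ 2 = (l / G) ^ 2 + l / G := by
    rw [← hl]
    field_simp
  rw [hu, sum_sq_add_self_pow, CharTwo.add_eq_zero, div_pow, hGd, div_left_inj' hG]

theorem quadratic_zeros {F G b y : K} (hF : F ≠ 0)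
    (hy : y ^ 2 + y = b * F / G ^ 2) (hG : G ≠ 0) (x : K) :
    F * x ^ 2 + G * x + b = 0 ↔ x = G / F * y ∨ x = G / F * y + G / F := by
  rw [eq_div_iff (pow_ne_zero 2 hG)] at hy
  have : F * (F * x ^ 2 + G * x + b) = (F * x + G * y) * (F * x + G * y + G) := by grind
  rw [← mul_right_inj' hF, this, mul_zero, mul_eq_zero, CharTwo.add_eq_zero, add_assoc,
    CharTwo.add_eq_zero]
  have h1 : x = G / F * y ↔ F * x = G * y := by
    field_simp
  have h2 : x = G / F * y + G / F ↔ F * x = G * y + G := by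
    field_simp
  rw [h1, h2]

theorem sq_injective {x y : K} (h : x ^ 2 = y ^ 2) : x = y :=
  (frobenius K 2).injective h

theorem sum_pow_div_add_one {n : ℕ} {e z : K} (he : e ^ 2 ^ n = e) (hz1 : z ≠ 1)
    (hz : z ^ (2 ^ n + 1) = 1) :
    (∑ i ∈ Finset.range n, (e / (z + 1)) ^ 2 ^ i) ^ 2 +
      ∑ i ∈ Finset.range n, (e / (z + 1)) ^ 2 ^ i = e := by
  rw [sum_pow_sq_add_self, div_pow, he, add_pow_char_pow, one_pow]
  have hz0 : z + 1 ≠ 0 := by rwa [Ne, CharTwo.add_eq_zero]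
  have hz' : z ^ 2 ^ n + 1 ≠ 0 := by
    rw [Ne, CharTwo.add_eq_zero]
    intro h
    rw [pow_succ, h, one_mul] at hz
    exact hz1 hz
  rw [pow_succ] at hz
  field_simp
  grind

/-- If the associated matrix is scalar then the trinomial has at least three zeros. -/
theorem two_lt_ncard_of_eq_zero [IsAlgClosed K] {n k r : ℕ} (hn : 0 < n) (hk : 0 < k)
    (hnm : n ∣ k * (r + 1)) (hdvd : ∀ i, n ∣ k * i → r + 1 ∣ i)
    {a : K} (ha : a ≠ 0) (haQ : a ^ 2 ^ n = a)
    (f : ℕ → K) (h0 : f 0 = 0) (h1 : f 1 = 1)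
    (hf : ∀ r, f (r + 2) = iterateFrobenius K 2 k (f (r + 1)) + iterateFrobenius K 2 k a *
      iterateFrobenius K 2 k (iterateFrobenius K 2 k (f r)))
    (hF : f (r + 1) = 0) (hG : f (r + 2) = a * iterateFrobenius K 2 k (f r)) :
    2 < {x : K | x ^ 2 ^ n = x ∧ x ^ (2 ^ k + 1) + x + a = 0}.ncard := by
  set σ := iterateFrobenius K 2 k with hσ
  set τ := iterateFrobenius K 2 n with hτ
  have hσi : ∀ i (x : K), σ^[i] x = x ^ 2 ^ (k * i) := by
    intro i x
    rw [hσ, coe_iterateFrobenius, ← Function.iterate_mul, ← coe_iterateFrobenius,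
      iterateFrobenius_def]
  have hστ : ∀ x, τ (σ x) = σ (τ x) := fun x => by
    simp only [hσ, hτ, iterateFrobenius_def]
    exact pow_right_comm _ _ _
  have hτx : ∀ x, τ x = x ↔ x ^ 2 ^ n = x := fun x => by rw [hτ, iterateFrobenius_def]
  obtain ⟨c, hca⟩ := IsAlgClosed.exists_pow_nat_eq a (n := 2) two_pos
  have hc0 : c ≠ 0 := by
    rintro rfl
    exact ha (by rw [← hca]; simp)
  have hc : τ c = c := by
    rw [hτx]
    apply sq_injective
    rw [pow_right_comm, hca, haQ]
  have hprod : ∏ i ∈ Finset.range (r + 1), σ^[i] c = f (r + 2) := by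
    apply sq_injective
    have hdet := det_shiftRec σ a f h0 h1 hf r
    rw [hF, ← hG] at hdet
    simp only [mul_zero, zero_mul, add_zero] at hdet
    rw [sq (f (r + 2)), hdet, ← Finset.prod_pow]
    refine Finset.prod_congr rfl fun i _ => ?_
    rw [hσi, hσi, pow_right_comm, hca]
  have hprod0 : f (r + 2) ≠ 0 := by
    rw [← hprod, Finset.prod_ne_zero_iff]
    intro i _
    rw [hσi]
    exact pow_ne_zero _ hc0
  have hper : ∀ v : K × K, τ v.1 = v.1 → τ v.2 = v.2 → (twist σ c)^[r + 1] v = v := by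
    intro v hv1 hv2
    have hfix : ∀ x, τ x = x → σ^[r + 1] x = x := fun x hx => by
      rw [hσi]
      exact pow_two_pow_of_dvd ((hτx x).1 hx) hnm
    obtain ⟨e1, e2⟩ := twist_iterate σ a c hc0 hca f h0 h1 hf v r
    rw [hprod, hF, hfix _ hv1, hfix _ hv2, map_zero, mul_zero, zero_mul, add_zero, ← hG] at e1
    rw [hprod, hF, hfix _ hv1, hfix _ hv2, zero_mul, zero_add] at e2
    exact Prod.ext (mul_left_cancel₀ hprod0 e1) (mul_left_cancel₀ hprod0 e2)
  have hind : ∀ g : ℕ → K,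
      (∀ l, τ l = l → ∑ i ∈ Finset.range (r + 1), σ^[i] l * g i = 0) → g 0 = 0 := by
    intro g hg
    refine coeff_zero_of_sum_frobenius hn r.succ_pos hdvd g fun l hl => ?_
    have := hg l ((hτx l).2 hl)
    simpa only [hσi] using this
  have hmem : ∀ x, (τ x = x ∧ σ x * x + x + c ^ 2 = 0) →
      x ∈ {x : K | x ^ 2 ^ n = x ∧ x ^ (2 ^ k + 1) + x + a = 0} := by
    rintro x ⟨hx1, hx2⟩
    refine ⟨(hτx x).1 hx1, ?_⟩
    rw [pow_succ, ← hca]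
    exact hx2
  obtain ⟨x, y, z, hx, hy, hz, hne⟩ := exists_three_roots σ τ hστ c hc hc0 (r + 1) hper hind
  rw [Set.two_lt_ncard_iff (finite_zeros _ _ (Nat.le_self_pow hk.ne' 2))]
  exact ⟨x, y, z, hmem x hx, hmem y hy, hmem z hz, hne⟩

theorem card_trichotomy {F G H : Prop} {N : ℕ} (h0 : ¬G → ¬H → N = 0) (h1 : ¬F → G → N = 1)
    (h2 : ¬G → H → N = 2) (h3 : F → 2 < N) :
    (N = 0 ↔ ¬G ∧ ¬H) ∧ (N = 1 ↔ ¬F ∧ G) ∧ (N = 2 ↔ ¬G ∧ H) := by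
  by_cases hF : F <;> by_cases hG : G <;> by_cases hH : H <;> grind

theorem trinomial_zeros [IsAlgClosed K] [Algebra (ZMod 2) K] (k n : ℕ) (hk : 1 ≤ k) (hn : 1 ≤ n)
    (d m : ℕ) (hd : d = Nat.gcd n k) (hm : m = n / d) (hm2 : 2 ≤ m)
    (A : ℕ → Polynomial (ZMod 2)) (hA1 : A 1 = 1) (hA2 : A 2 = -1)
    (hA : ∀ r : ℕ, 1 ≤ r → A (r + 2) = -(A (r + 1)) ^ 2 ^ k - X ^ 2 ^ k * A r ^ (2 ^ k) ^ 2)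
    (a : K) (haQ : a ^ 2 ^ n = a) (ha0 : a ≠ 0)
    (Fa Ga Nr H E : K)
    (hFa : Fa = aeval a (A m))
    (hGa : Ga = -(aeval a (A (m + 1))) - a * (aeval a (A (m - 1))) ^ 2 ^ k)
    (hNr : Nr = a ^ ((2 ^ n - 1) / (2 ^ d - 1)))
    (hH : H = ∑ i ∈ Finset.range d, (Nr / Ga ^ 2) ^ 2 ^ i)
    (hE : E = a * Fa ^ (2 ^ k + 1) / Ga ^ 2)
    (Na : ℕ)
    (hNa : Na = {x : K |
      x ^ 2 ^ n = x ∧ x ^ (2 ^ k + 1) + x + a = 0}.ncard) :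
    Ga ^ 2 ^ d = Ga ∧
    (Na = 0 ↔ (Ga ≠ 0 ∧ H ≠ 0)) ∧
    ((Na = 1 ↔ (Fa ≠ 0 ∧ Ga = 0)) ∧
      (Fa ≠ 0 → Ga = 0 →
        (∃! y : K, y ^ 2 ^ n = y ∧ y ^ 2 = a * Fa ^ (2 ^ k - 1)) ∧
        ∀ y : K, y ^ 2 ^ n = y → y ^ 2 = a * Fa ^ (2 ^ k - 1) →
          {x : K | x ^ 2 ^ n = x ∧ x ^ (2 ^ k + 1) + x + a = 0} = {y})) ∧
    ((Na = 2 ↔ (Ga ≠ 0 ∧ H = 0)) ∧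
      (Ga ≠ 0 → H = 0 →
        ∀ ζ : K, ζ ≠ 1 → ζ ^ (2 ^ n + 1) = 1 →
          {x : K | x ^ 2 ^ n = x ∧ x ^ (2 ^ k + 1) + x + a = 0} =
            {Ga / Fa * ∑ i ∈ Finset.range n, (E / (ζ + 1)) ^ 2 ^ i,
             Ga / Fa * ∑ i ∈ Finset.range n, (E / (ζ + 1)) ^ 2 ^ i + Ga / Fa})) := by
  have hd0 : 0 < d := hd ▸ Nat.gcd_pos_of_pos_left k hn
  have hdn : d ∣ n := hd ▸ Nat.gcd_dvd_left n k
  have hnm : n = d * m := by rw [hm, Nat.mul_div_cancel' hdn]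
  obtain ⟨r, rfl⟩ : ∃ r, m = r + 1 := ⟨m - 1, by omega⟩
  have hdvd : ∀ i, n ∣ k * i → r + 1 ∣ i := by
    intro i hi
    obtain ⟨k', hk'⟩ : d ∣ k := hd ▸ Nat.gcd_dvd_right n k
    have hcop : Nat.Coprime (r + 1) k' := by
      rw [hnm, hk', Nat.gcd_mul_left] at hd
      exact Nat.eq_of_mul_eq_mul_left hd0 (by rw [← hd, mul_one])
    rw [hnm, hk', mul_assoc] at hi
    exact hcop.dvd_of_dvd_mul_left (Nat.dvd_of_mul_dvd_mul_left hd0 hi)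
  have hnkm : n ∣ k * (r + 1) := by
    rw [hnm]
    exact Nat.mul_dvd_mul_right (hd ▸ Nat.gcd_dvd_right n k) _
  have htwo : (2 : K) = 0 := CharTwo.two_eq_zero
  obtain ⟨σ, hσ⟩ : ∃ σ, σ = iterateFrobenius K 2 k := ⟨_, rfl⟩
  obtain ⟨τ, hτ⟩ : ∃ τ, τ = iterateFrobenius K 2 n := ⟨_, rfl⟩
  have hσx : ∀ x, σ x = x ^ 2 ^ k := fun x => by rw [hσ, iterateFrobenius_def]
  have hτx : ∀ x, τ x = x ^ 2 ^ n := fun x => by rw [hτ, iterateFrobenius_def]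
  have hστ : ∀ x, τ (σ x) = σ (τ x) := fun x => by
    simp only [hσx, hτx]
    exact pow_right_comm _ _ _
  have hσi : ∀ i (x : K), σ^[i] x = x ^ 2 ^ (k * i) := by
    intro i x
    rw [hσ, coe_iterateFrobenius, ← Function.iterate_mul, ← coe_iterateFrobenius,
      iterateFrobenius_def]
  have hσm : ∀ x, x ^ 2 ^ n = x → σ^[r + 1] x = x := fun x hx => by
    rw [hσi]
    exact pow_two_pow_of_dvd hx hnkm
  obtain ⟨f, h0, hfA⟩ : ∃ f : ℕ → K, f 0 = 0 ∧ ∀ i, 1 ≤ i → f i = aeval a (A i) :=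
    ⟨fun i => if i = 0 then 0 else aeval a (A i), if_pos rfl,
      fun i hi => if_neg (by omega)⟩
  have h1 : f 1 = 1 := by rw [hfA 1 le_rfl, hA1, map_one]
  have hf : ∀ i, f (i + 2) = σ (f (i + 1)) + σ a * σ (σ (f i)) := by
    intro i
    rcases Nat.eq_zero_or_pos i with rfl | hi
    · rw [h0, h1, hfA _ (by omega), hA2]
      simp [CharTwo.neg_eq]
    · rw [hfA _ (by omega), hfA _ (by omega), hfA _ hi, hA i hi]
      simp only [hσx, CharTwo.neg_eq, CharTwo.sub_eq_add, map_add, map_mul, map_pow, aeval_X]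
      rw [sq, pow_mul]
  have hFr : f (r + 1) = Fa := by rw [hFa, hfA _ (by omega)]
  have hGr : Ga = f (r + 2) + a * σ (f r) := by
    rw [hGa, hfA _ (by omega), hfA r (by omega), hσx, CharTwo.neg_eq, CharTwo.sub_eq_add]
    rfl
  have hτf : ∀ i, τ (f i) = f i :=
    map_shiftRec σ τ hστ a (by rw [hτx, haQ]) f h0 h1 hf
  have hN : f (r + 2) * (a * σ (f r)) + a * Fa * σ Fa = Nr := by
    rw [← hFr, det_shiftRec σ a f h0 h1 hf r, hNr,
      ← prod_conjugates hd0 hd hnm (by omega) haQ]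
    exact Finset.prod_congr rfl fun i _ => hσi i a
  have h2 : σ (f (r + 2)) + σ a * σ (σ Fa) = f (r + 2) + a * Fa := by
    rw [← hFr, ← hf (r + 1), shiftRec_left σ a f h0 h1 hf (r + 1), hσm a haQ]
  have h3 : f (r + 2) = σ Fa + σ a * σ (σ (f r)) := by rw [← hFr, hf r]
  have h4 : σ (f (r + 2)) = σ Fa + a * σ (f r) := by
    rw [shiftRec_left σ a f h0 h1 hf r, map_add, map_mul, ← Function.iterate_succ_apply' σ,
      hσm a haQ, hFr]
  have hσG : σ Ga = Ga := by
    rw [hGr, map_add, map_mul]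
    linear_combination h4 - h3
  have hGn : Ga ^ 2 ^ n = Ga := by
    rw [← hτx, hGr, map_add, map_mul, hστ, hτf, hτf, hτx, haQ]
  have hGd : Ga ^ 2 ^ d = Ga := by
    rw [hd]
    exact pow_two_pow_gcd hGn (by rw [← hσx, hσG])
  have hFn : Fa ^ 2 ^ n = Fa := by rw [← hτx, ← hFr, hτf]
  have hG0 : Fa = 0 → Ga = 0 := by
    intro h
    simp only [h, map_zero, mul_zero, add_zero, zero_add] at h2 h4
    rw [hGr, ← h2, h4, CharTwo.add_self_eq_zero]
  have hqpos : 0 < 2 ^ k := by positivity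
  obtain ⟨S, hS⟩ : ∃ S, S = {x : K | x ^ 2 ^ n = x ∧ x ^ (2 ^ k + 1) + x + a = 0} := ⟨_, rfl⟩
  rw [← hS] at hNa ⊢
  have hmem : Fa ≠ 0 → ∀ x, x ∈ S ↔
      Fa * x ^ 2 + Ga * x + a * Fa ^ 2 ^ k = 0 ∧
        (Fa * x + a * σ (f r)) ^ 2 ^ d = Fa * x + a * σ (f r) := by
    intro hF x
    rw [hGr, hd, hS]
    refine root_iff ha0 hF haQ hFn (by rw [← hτx, hστ, hτf]) ?_ ?_
    · simpa only [hσx] using h3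
    · intro hxn hx
      have := root_iterate σ a f h0 h1 hf x (by rw [hσx, ← pow_succ, hx]) r
      rw [hσm x hxn, hFr] at this
      rw [← hσx]
      linear_combination this + (f (r + 2) * x + a * σ Fa) * htwo
  have heig : ∀ x, Fa * x ^ 2 + Ga * x + a * Fa ^ 2 ^ k = 0 →
      (Fa * x + a * σ (f r)) ^ 2 + Ga * (Fa * x + a * σ (f r)) = Nr := by
    intro x hx
    rw [← hσx, hGr] at hx
    rw [← hN, hGr]
    linear_combination Fa * hx +
      (Fa * a * σ (f r) * x + a ^ 2 * σ (f r) ^ 2 - a * Fa * σ Fa) * htwo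
  have hNd : Nr ^ 2 ^ d = Nr := by
    rw [hd]
    refine pow_two_pow_gcd (by rw [hNr, pow_right_comm, haQ]) ?_
    rw [← hσx, ← hN]
    simp only [map_add, map_mul]
    linear_combination -σ (f (r + 2)) * h3 + σ Fa * h2 + f (r + 2) * h4 +
      (f (r + 2) * σ Fa - σ (f (r + 2)) * σ Fa) * htwo
  have hsing : Fa ≠ 0 → Ga = 0 → ∀ y : K, y ^ 2 = a * Fa ^ (2 ^ k - 1) → S = {y} := by
    intro hF hG y hy
    have hquad : ∀ x, Fa * x ^ 2 + Ga * x + a * Fa ^ 2 ^ k = 0 ↔ x = y := by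
      intro x
      have hpow : Fa ^ 2 ^ k = Fa * Fa ^ (2 ^ k - 1) := by
        rw [← pow_succ', Nat.sub_add_cancel hqpos]
      rw [hG, zero_mul, add_zero, CharTwo.add_eq_zero, hpow, mul_left_comm, ← hy,
        mul_right_inj' hF]
      exact ⟨fun h => sq_injective h, fun h => by rw [h]⟩
    ext x
    rw [hmem hF, hquad, Set.mem_singleton_iff, and_iff_left_iff_imp]
    rintro rfl
    have he := heig x ((hquad x).2 rfl)
    rw [hG, zero_mul, add_zero] at he
    apply sq_injective
    rw [pow_right_comm, he, hNd]
  have hsqrt : ∃ y : K, y ^ 2 ^ n = y ∧ y ^ 2 = a * Fa ^ (2 ^ k - 1) := by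
    obtain ⟨y, hy⟩ := IsAlgClosed.exists_pow_nat_eq (a * Fa ^ (2 ^ k - 1)) two_pos
    refine ⟨y, sq_injective ?_, hy⟩
    rw [pow_right_comm, hy, mul_pow, haQ, pow_right_comm, hFn]
  have hpair : Ga ≠ 0 → H = 0 → ∀ y : K, y ^ 2 + y = E →
      S = {Ga / Fa * y, Ga / Fa * y + Ga / Fa} := by
    intro hG hH0 y hy
    have hF : Fa ≠ 0 := fun h => hG (hG0 h)
    rw [hE] at hy
    ext x
    rw [hmem hF, quadratic_zeros hF (by rw [hy, pow_succ, mul_assoc]) hG, Set.mem_insert_iff,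
      Set.mem_singleton_iff, and_iff_left_iff_imp,
      ← quadratic_zeros hF (b := a * Fa ^ 2 ^ k) (by rw [hy, pow_succ, mul_assoc]) hG]
    intro hx
    rw [← sum_pow_eq_zero_iff hG hGd (heig x hx), ← hH, hH0]
  have hempty : Ga ≠ 0 → H ≠ 0 → S = ∅ := by
    intro hG hH0
    have hF : Fa ≠ 0 := fun h => hG (hG0 h)
    refine Set.eq_empty_iff_forall_notMem.2 fun x hx => hH0 ?_
    obtain ⟨hquad, hl⟩ := (hmem hF x).1 hx
    rw [hH, sum_pow_eq_zero_iff hG hGd (heig x hquad), hl]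
  have hN0 : Ga ≠ 0 → H ≠ 0 → Na = 0 := fun hG hH0 => by
    rw [hNa, hempty hG hH0, Set.ncard_empty]
  have hN1 : Fa ≠ 0 → Ga = 0 → Na = 1 := fun hF hG => by
    obtain ⟨y, -, hy⟩ := hsqrt
    rw [hNa, hsing hF hG y hy, Set.ncard_singleton]
  have hN2 : Ga ≠ 0 → H = 0 → Na = 2 := fun hG hH0 => by
    have hF : Fa ≠ 0 := fun h => hG (hG0 h)
    obtain ⟨y, hy⟩ : ∃ y : K, y ^ 2 + y = E := by
      obtain ⟨y, hy⟩ := IsAlgClosed.exists_root (X ^ 2 + X + C E : K[X]) (by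
        have : (X ^ 2 + X + C E : K[X]).degree = 2 := by compute_degree!
        rw [this]
        norm_num)
      refine ⟨y, CharTwo.add_eq_zero.1 ?_⟩
      simpa [IsRoot] using hy
    rw [hNa, hpair hG hH0 y hy, Set.ncard_pair]
    simp [hG, hF]
  have hN3 : Fa = 0 → 2 < Na := fun hF => by
    have hG := hG0 hF
    rw [hGr, CharTwo.add_eq_zero] at hG
    rw [hNa, hS]
    exact two_lt_ncard_of_eq_zero hn hk hnkm hdvd ha0 haQ f h0 h1 (hσ ▸ hf) (hFr.trans hF) (hσ ▸ hG)
  obtain ⟨hc0, hc1, hc2⟩ := card_trichotomy hN0 hN1 hN2 hN3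
  refine ⟨hGd, hc0, ⟨hc1, ?_⟩, hc2, ?_⟩
  · intro hF hG
    obtain ⟨y, hyn, hy⟩ := hsqrt
    exact ⟨⟨y, ⟨hyn, hy⟩, fun z hz => sq_injective (hz.2.trans hy.symm)⟩,
      fun z _ hz => hsing hF hG z hz⟩
  · intro hG hH0 ζ hζ1 hζ
    refine hpair hG hH0 _ (sum_pow_div_add_one ?_ hζ1 hζ)
    rw [hE, div_pow, mul_pow, haQ, pow_right_comm, hFn, pow_right_comm, hGn]

end

theorem stmt_6 (p k n : ℕ) [Fact p.Prime] (hp2 : p = 2) (hk : 1 ≤ k) (hn : 1 ≤ n)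
    (d m q Q : ℕ) (hd : d = Nat.gcd n k) (hm : m = n / d) (hm2 : 2 ≤ m)
    (hq : q = p ^ k) (hQ : Q = p ^ n)
    (A : ℕ → Polynomial (ZMod p)) (hA1 : A 1 = 1) (hA2 : A 2 = -1)
    (hA : ∀ r : ℕ, 1 ≤ r → A (r + 2) = -(A (r + 1)) ^ q - X ^ q * A r ^ q ^ 2)
    (a : AlgebraicClosure (ZMod p)) (haQ : a ^ Q = a) (ha0 : a ≠ 0)
    (Fa Ga Nr H E : AlgebraicClosure (ZMod p))
    (hFa : Fa = aeval a (A m))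
    (hGa : Ga = -(aeval a (A (m + 1))) - a * (aeval a (A (m - 1))) ^ q)
    (hNr : Nr = a ^ ((Q - 1) / (p ^ d - 1)))
    (hH : H = ∑ i ∈ Finset.range d, (Nr / Ga ^ 2) ^ 2 ^ i)
    (hE : E = a * Fa ^ (q + 1) / Ga ^ 2)
    (Na : ℕ)
    (hNa : Na = {x : AlgebraicClosure (ZMod p) |
      x ^ Q = x ∧ x ^ (q + 1) + x + a = 0}.ncard) :
    Ga ^ p ^ d = Ga ∧
    (Na = 0 ↔ (Ga ≠ 0 ∧ H ≠ 0)) ∧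
    ((Na = 1 ↔ (Fa ≠ 0 ∧ Ga = 0)) ∧
      (Fa ≠ 0 → Ga = 0 →
        (∃! y : AlgebraicClosure (ZMod p), y ^ Q = y ∧ y ^ 2 = a * Fa ^ (q - 1)) ∧
        ∀ y : AlgebraicClosure (ZMod p), y ^ Q = y → y ^ 2 = a * Fa ^ (q - 1) →
          {x : AlgebraicClosure (ZMod p) | x ^ Q = x ∧ x ^ (q + 1) + x + a = 0} = {y})) ∧
    ((Na = 2 ↔ (Ga ≠ 0 ∧ H = 0)) ∧
      (Ga ≠ 0 → H = 0 →
        ∀ ζ : AlgebraicClosure (ZMod p), ζ ≠ 1 → ζ ^ (Q + 1) = 1 →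
          {x : AlgebraicClosure (ZMod p) | x ^ Q = x ∧ x ^ (q + 1) + x + a = 0} =
            {Ga / Fa * ∑ i ∈ Finset.range n, (E / (ζ + 1)) ^ 2 ^ i,
             Ga / Fa * ∑ i ∈ Finset.range n, (E / (ζ + 1)) ^ 2 ^ i + Ga / Fa})) := by
  subst hp2 hq hQ
  exact trinomial_zeros k n hk hn d m hd hm hm2 A hA1 hA2 hA a haQ ha0 Fa Ga Nr H E hFa hGa hNr
    hH hE Na hNa
end

section
/- Let a ∈ GF(Q)*. The following are equivalent: (1) P_a(X) has exactly p^d + 1 zeros in GF(Q); (2) A_m(a) = 0; (3) there exists u ∈ GF(Q) with u ∉ GF(p^{2d}) such that a = (u - u^q)^{q^2+1} / (u - u^{q^2})^{q+1}. Moreover, for u as in (3), the p^d + 1 zeros of P_a(X) in GF(Q) are x_0 = -1/(1 + (u - u^q)^{q-1}) and x_α = -(u + α)^{q^2 - q}/(1 + (u - u^q)^{q-1}) for α ∈ GF(p^d). -/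
open Polynomial

section Semilinear

variable {K : Type*} [Field K] (σ : K →+* K)

theorem prod_iterate_eq_of_root {a x : K} {b : ℕ → K} (h0 : b 0 = 0) (h1 : b 1 = 1)
    (hb : ∀ r, b (r + 2) = -σ (b (r + 1)) - σ a * σ (σ (b r)))
    (hx : σ x * x + x + a = 0) (r : ℕ) :
    ∏ i ∈ Finset.range (r + 1), σ^[i] x = b (r + 1) * x - a * σ (b r) := by
  induction r with
  | zero => simp [h0, h1]
  | succ r ih =>
    have h := congrArg σ ih
    rw [map_prod] at h
    simp only [← Function.iterate_succ_apply' σ, map_sub, map_mul] at h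
    rw [Finset.prod_range_succ', h, hb]
    simp only [Function.iterate_zero, id]
    linear_combination σ (b (r + 1)) * hx

theorem eq_zero_of_three_roots_quadratic {α β γ x y z : K} (hxy : x ≠ y) (hxz : x ≠ z)
    (hyz : y ≠ z) (hx : α * x ^ 2 + β * x + γ = 0) (hy : α * y ^ 2 + β * y + γ = 0)
    (hz : α * z ^ 2 + β * z + γ = 0) : α = 0 := by
  have h1 : α * (x + y) + β = 0 := by
    apply mul_left_cancel₀ (sub_ne_zero.2 hxy)
    linear_combination hx - hy
  have h2 : α * (x + z) + β = 0 := by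
    apply mul_left_cancel₀ (sub_ne_zero.2 hxz)
    linear_combination hx - hz
  apply mul_right_cancel₀ (sub_ne_zero.2 hyz)
  linear_combination h1 - h2

/-- If `X σ(X) + X + a` has three roots fixed by `σ ^ (r + 1)`, then the recurrence
vanishes at `r + 1`. -/
theorem recurrence_eq_zero_of_three_roots {a x y z : K} {b : ℕ → K} (h0 : b 0 = 0)
    (h1 : b 1 = 1) (hb : ∀ r, b (r + 2) = -σ (b (r + 1)) - σ a * σ (σ (b r))) (r : ℕ)
    (hxy : x ≠ y) (hxz : x ≠ z) (hyz : y ≠ z)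
    (hx : σ x * x + x + a = 0) (hy : σ y * y + y + a = 0) (hz : σ z * z + z + a = 0)
    (hxr : σ^[r + 1] x = x) (hyr : σ^[r + 1] y = y) (hzr : σ^[r + 1] z = z) :
    b (r + 1) = 0 := by
  have key : ∀ t : K, σ t * t + t + a = 0 → σ^[r + 1] t = t →
      b (r + 1) * t ^ 2 + (-a * σ (b r) - b (r + 2)) * t + a * σ (b (r + 1)) = 0 := by
    intro t ht htr
    have e1 := prod_iterate_eq_of_root σ h0 h1 hb ht (r + 1)
    rw [Finset.prod_range_succ, prod_iterate_eq_of_root σ h0 h1 hb ht r, htr] at e1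
    linear_combination e1
  exact eq_zero_of_three_roots_quadratic hxy hxz hyz (key x hx hxr) (key y hy hyr) (key z hz hzr)

/-- The twisted inverse companion map whose fixed vectors `(y, l σ(y))` correspond to solutions
of `l σ(l) σ²(y) + l σ(y) + a y = 0`. -/
def twistedCompanion (l a : K) : K × K →ₛₗ[σ] K × K where
  toFun v := (-(l * (σ v.1 + σ v.2)) / a, l * σ v.1)
  map_add' v w := by ext <;> simp <;> ring
  map_smul' c v := by ext <;> simp <;> ring

theorem twistedCompanion_apply (l a : K) (v : K × K) :
    twistedCompanion σ l a v = (-(l * (σ v.1 + σ v.2)) / a, l * σ v.1) := rfl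

theorem twistedCompanion_iterate_eq_smul (l a : K) (v : K × K) (i : ℕ) :
    (twistedCompanion σ l a)^[i] v =
      (∏ j ∈ Finset.range i, σ^[j] l) • (twistedCompanion σ 1 a)^[i] v := by
  induction i with
  | zero => simp
  | succ i ih =>
    rw [Function.iterate_succ_apply', ih, map_smulₛₗ, map_prod,
      Function.iterate_succ_apply' (twistedCompanion σ 1 a), Finset.prod_range_succ']
    simp only [← Function.iterate_succ_apply' σ, Function.iterate_zero, id]
    ext <;> simp [twistedCompanion_apply] <;> ring

theorem twistedCompanion_iterate_smul (l a t : K) (v : K × K) (i : ℕ) :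
    (twistedCompanion σ l a)^[i] (t • v) = σ^[i] t • (twistedCompanion σ l a)^[i] v := by
  induction i with
  | zero => simp
  | succ i ih => simp only [Function.iterate_succ_apply', ih, map_smulₛₗ]

theorem twistedCompanion_iterate_relation {a : K} {b : ℕ → K} (ha : a ≠ 0) (h0 : b 0 = 0)
    (h1 : b 1 = 1) (hb : ∀ r, b (r + 2) = -σ (b (r + 1)) - σ a * σ (σ (b r))) (v : K × K)
    (r : ℕ) :
    -a * σ (b r) * ((twistedCompanion σ 1 a)^[r + 1] v).1 +
        b (r + 1) * ((twistedCompanion σ 1 a)^[r + 1] v).2 = σ^[r + 1] v.1 ∧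
      -a * σ (b (r + 1)) * ((twistedCompanion σ 1 a)^[r + 1] v).1 +
        b (r + 2) * ((twistedCompanion σ 1 a)^[r + 1] v).2 = σ^[r + 1] v.2 := by
  induction r with
  | zero =>
    have h2 : b 2 = -1 := by simpa [h0, h1] using hb 0
    simp only [zero_add, Function.iterate_one, twistedCompanion_apply, h0, h1, h2, map_zero,
      map_one]
    constructor <;> field_simp <;> ring
  | succ r ih =>
    obtain ⟨ih1, ih2⟩ := ih
    rw [Function.iterate_succ_apply' _ (r + 1), Function.iterate_succ_apply' σ (r + 1),
      Function.iterate_succ_apply' σ (r + 1), ← ih1, ← ih2]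
    generalize (twistedCompanion σ 1 a)^[r + 1] v = w
    simp only [twistedCompanion_apply, map_add, map_mul, map_neg]
    constructor
    · rw [show r + 1 + 1 = r + 2 from rfl, hb r]
      field_simp
      ring
    · rw [hb (r + 1)]
      field_simp
      ring

theorem root_of_twistedCompanion_fixed {l a : K} {v : K × K} (ha : a ≠ 0)
    (hv : twistedCompanion σ l a v = v) (hv1 : v.1 ≠ 0) :
    σ (v.2 / v.1) * (v.2 / v.1) + v.2 / v.1 + a = 0 := by
  have e1 := congrArg Prod.fst hv
  have e2 := congrArg Prod.snd hv
  simp only [twistedCompanion_apply] at e1 e2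
  have hs : σ v.1 ≠ 0 := by simpa using hv1
  rw [map_div₀]
  field_simp at e1 ⊢
  linear_combination (-σ v.1) * e1 - (σ v.1 + σ v.2) * e2

theorem sum_twistedCompanion_iterate_fixed {l a : K} {v : K × K} {m : ℕ}
    (hv : (twistedCompanion σ l a)^[m] v = v) :
    twistedCompanion σ l a (∑ i ∈ Finset.range m, (twistedCompanion σ l a)^[i] v) =
      ∑ i ∈ Finset.range m, (twistedCompanion σ l a)^[i] v := by
  have h := Finset.sum_range_succ' (fun i => (twistedCompanion σ l a)^[i] v) m
  rw [Finset.sum_range_succ, hv] at h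
  simp only [Function.iterate_zero, id] at h
  rw [map_sum]
  simp only [← Function.iterate_succ_apply' (twistedCompanion σ l a)]
  exact (add_right_cancel h).symm

/-- Over a subfield `F` on which `σ` has order `r + 1`, satisfies independence of its powers and
has surjective norm, vanishing of the recurrence at `r + 1` produces three roots in `F`. -/
theorem three_roots_of_recurrence_eq_zero (F : Subfield K) {a : K} {b : ℕ → K} (haF : a ∈ F)
    (ha : a ≠ 0) (h0 : b 0 = 0) (h1 : b 1 = 1)
    (hb : ∀ r, b (r + 2) = -σ (b (r + 1)) - σ a * σ (σ (b r))) (r : ℕ)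
    (hσF : ∀ x ∈ F, σ x ∈ F) (hσr : ∀ x ∈ F, σ^[r + 1] x = x)
    (hind : ∀ g : ℕ → K,
      (∀ t ∈ F, ∑ i ∈ Finset.range (r + 1), g i * σ^[i] t = 0) → g 0 = 0)
    (hnorm : ∀ c ∈ F, c ≠ 0 → σ c = c → ∃ l ∈ F, ∏ i ∈ Finset.range (r + 1), σ^[i] l = c)
    (hr : b (r + 1) = 0) :
    ∃ x ∈ F, ∃ y ∈ F, ∃ z ∈ F, x ≠ y ∧ x ≠ z ∧ y ≠ z ∧ σ x * x + x + a = 0 ∧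
      σ y * y + y + a = 0 ∧ σ z * z + z + a = 0 := by
  have hTF : ∀ l ∈ F, ∀ v : K × K, v.1 ∈ F → v.2 ∈ F → ∀ i : ℕ,
      ((twistedCompanion σ l a)^[i] v).1 ∈ F ∧ ((twistedCompanion σ l a)^[i] v).2 ∈ F := by
    intro l hl v hv1 hv2 i
    induction i with
    | zero => exact ⟨hv1, hv2⟩
    | succ i ih =>
      rw [Function.iterate_succ_apply', twistedCompanion_apply]
      exact ⟨F.div_mem (F.neg_mem (F.mul_mem hl (F.add_mem (hσF _ ih.1) (hσF _ ih.2)))) haF,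
        F.mul_mem hl (hσF _ ih.1)⟩
  set c := -a * σ (b r) with hc
  have hcσ : b (r + 2) = σ c := by rw [hb, hr, hc]; simp
  have hT : ∀ v : K × K, v.1 ∈ F → v.2 ∈ F →
      c * ((twistedCompanion σ 1 a)^[r + 1] v).1 = v.1 ∧
      σ c * ((twistedCompanion σ 1 a)^[r + 1] v).2 = v.2 := by
    intro v hv1 hv2
    have h := twistedCompanion_iterate_relation σ ha h0 h1 hb v r
    rw [hr, hcσ, hσr _ hv1, hσr _ hv2] at h
    simpa [hc] using h
  obtain ⟨e1, e2⟩ := hT (1, 0) F.one_mem F.zero_mem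
  have hc0 : c ≠ 0 := left_ne_zero_of_mul_eq_one e1
  have hσc0 : σ c ≠ 0 := (map_ne_zero σ).2 hc0
  have hcF : c ∈ F := by
    rw [eq_inv_of_mul_eq_one_left e1]
    exact F.inv_mem (hTF 1 F.one_mem (1, 0) F.one_mem F.zero_mem (r + 1)).1
  have hcfix : σ c = c := by
    have hT1 := hTF 1 F.one_mem (1, 0) F.one_mem F.zero_mem 1
    have e3 := (hT _ hT1.1 hT1.2).1
    rw [← Function.iterate_add_apply, add_comm, Function.iterate_add_apply,
      Function.iterate_one] at e3
    have e2' : ((twistedCompanion σ 1 a)^[r + 1] (1, 0)).2 = 0 := by simpa [hc0] using e2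
    simp only [twistedCompanion_apply, e2', eq_inv_of_mul_eq_one_right e1, map_inv₀, map_zero,
      map_one] at e3
    field_simp at e3
    simpa using e3.symm
  obtain ⟨l, hl, hlc⟩ := hnorm c hcF hc0 hcfix
  have hS : ∀ v : K × K, v.1 ∈ F → v.2 ∈ F → (twistedCompanion σ l a)^[r + 1] v = v := by
    intro v hv1 hv2
    rw [twistedCompanion_iterate_eq_smul, hlc]
    have h := hT v hv1 hv2
    rw [hcfix] at h
    exact Prod.ext h.1 h.2
  have hex : ∀ (α β : K) (v : K × K), v.1 ∈ F → v.2 ∈ F → α * v.1 + β * v.2 ≠ 0 →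
      ∃ w : K × K, w.1 ∈ F ∧ w.2 ∈ F ∧ twistedCompanion σ l a w = w ∧
        α * w.1 + β * w.2 ≠ 0 := by
    intro α β v hv1 hv2 hv
    by_contra! hcon
    apply hv
    refine hind (fun i => α * ((twistedCompanion σ l a)^[i] v).1 +
      β * ((twistedCompanion σ l a)^[i] v).2) fun t ht => ?_
    have ht1 : (t • v).1 ∈ F := F.mul_mem ht hv1
    have ht2 : (t • v).2 ∈ F := F.mul_mem ht hv2
    have h := hcon (∑ i ∈ Finset.range (r + 1), (twistedCompanion σ l a)^[i] (t • v))
      (by rw [Prod.fst_sum]; exact F.sum_mem fun i _ => (hTF l hl _ ht1 ht2 i).1)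
      (by rw [Prod.snd_sum]; exact F.sum_mem fun i _ => (hTF l hl _ ht1 ht2 i).2)
      (sum_twistedCompanion_iterate_fixed σ (hS _ ht1 ht2))
    rw [← h, Prod.fst_sum, Prod.snd_sum, Finset.mul_sum, Finset.mul_sum, ← Finset.sum_add_distrib]
    refine Finset.sum_congr rfl fun i _ => ?_
    rw [twistedCompanion_iterate_smul]
    simp only [Prod.smul_fst, Prod.smul_snd, smul_eq_mul]
    ring
  have hne : ∀ w : K × K, twistedCompanion σ l a w = w → w.1 = 0 → w.2 = 0 := by
    intro w hw hw1
    have := congrArg Prod.snd hw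
    simpa [twistedCompanion_apply, hw1] using this.symm
  obtain ⟨v, hv1F, hv2F, hvfix, hv⟩ := hex 1 0 (1, 0) F.one_mem F.zero_mem (by simp)
  have hv1 : v.1 ≠ 0 := by simpa using hv
  obtain ⟨w, hw1F, hw2F, hwfix, hw⟩ := hex (-v.2) v.1 (0, 1) F.zero_mem F.one_mem (by simpa)
  have hw1 : w.1 ≠ 0 := fun h => hw (by rw [h, hne w hwfix h]; ring)
  have hvwfix : twistedCompanion σ l a (v + w) = v + w := by rw [map_add, hvfix, hwfix]
  have hvw1 : (v + w).1 ≠ 0 := fun h => hw (by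
    have h' := hne _ hvwfix h
    simp only [Prod.fst_add, Prod.snd_add] at h h'
    linear_combination v.1 * h' - v.2 * h)
  refine ⟨v.2 / v.1, F.div_mem hv2F hv1F, w.2 / w.1, F.div_mem hw2F hw1F,
    (v + w).2 / (v + w).1, F.div_mem (F.add_mem hv2F hw2F) (F.add_mem hv1F hw1F), ?_, ?_, ?_,
    root_of_twistedCompanion_fixed σ ha hvfix hv1, root_of_twistedCompanion_fixed σ ha hwfix hw1,
    root_of_twistedCompanion_fixed σ ha hvwfix hvw1⟩
  · rw [Ne, div_eq_div_iff hv1 hw1]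
    exact fun h => hw (by linear_combination -h)
  · rw [Ne, div_eq_div_iff hv1 hvw1]
    simp only [Prod.fst_add, Prod.snd_add]
    exact fun h => hw (by linear_combination -h)
  · rw [Ne, div_eq_div_iff hw1 hvw1]
    simp only [Prod.fst_add, Prod.snd_add]
    exact fun h => hw (by linear_combination h)

theorem parameter_of_three_roots {a x y z u : K} (ha : a ≠ 0) (hxy : x ≠ y) (hxz : x ≠ z)
    (hyz : y ≠ z) (hx : σ x * x + x + a = 0) (hy : σ y * y + y + a = 0)
    (hz : σ z * z + z + a = 0) (hu : σ u = (z - x) / (z - y)) :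
    u ≠ σ (σ u) ∧
      a = σ (σ (u - σ u)) * (u - σ u) / (σ (u - σ (σ u)) * (u - σ (σ u))) := by
  have hx0 : x ≠ 0 := by rintro rfl; simp [ha] at hx
  have hzy : z - y ≠ 0 := sub_ne_zero.2 hyz.symm
  have hσzy : σ z - σ y ≠ 0 := by rwa [← map_sub, _root_.map_ne_zero]
  have h2 : σ (σ u) * x = σ u * y := by
    have hy0 : y ≠ 0 := by rintro rfl; simp [ha] at hy
    have hz0 : z ≠ 0 := by rintro rfl; simp [ha] at hz
    have hx' : σ x = -(x + a) / x := by field_simp; linear_combination hx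
    have hy' : σ y = -(y + a) / y := by field_simp; linear_combination hy
    have hz' : σ z = -(z + a) / z := by field_simp; linear_combination hz
    have hσ : σ (σ u) * (σ z - σ y) = σ z - σ x := by
      rw [hu, map_div₀, map_sub, map_sub, div_mul_cancel₀ _ hσzy]
    have e1 : σ z - σ y = a * (z - y) / (y * z) := by rw [hz', hy']; field_simp; ring
    have e2 : σ z - σ x = a * (z - x) / (x * z) := by rw [hz', hx']; field_simp; ring
    rw [e1, e2] at hσ
    have hu' : σ u * (z - y) = z - x := by rw [hu, div_mul_cancel₀ _ hzy]
    apply mul_right_cancel₀ hzy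
    field_simp at hσ
    linear_combination hσ - y * hu'
  have h3 : σ (σ (σ u)) * σ x = σ (σ u) * σ y := by simpa using congrArg σ h2
  have h0 : u - σ u = -x * (u - σ (σ u)) := by
    apply σ.injective
    apply mul_left_cancel₀ hx0
    simp only [map_sub, map_mul, map_neg]
    linear_combination -x * h3 - (σ y + 1) * h2 + σ u * (hx - hy)
  have hne : u ≠ σ (σ u) := by
    intro h
    rw [← h, sub_self, mul_zero, sub_eq_zero] at h0
    rw [← h, ← h0] at h2
    have hu0 : u ≠ 0 := by
      rw [h0, hu]
      exact div_ne_zero (sub_ne_zero.2 hxz.symm) hzy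
    exact hxy (mul_left_cancel₀ hu0 h2)
  refine ⟨hne, ?_⟩
  have hD : u - σ (σ u) ≠ 0 := sub_ne_zero.2 hne
  have hσD : σ (u - σ (σ u)) ≠ 0 := (map_ne_zero σ).2 hD
  have h1 : σ (u - σ u) = -σ x * σ (u - σ (σ u)) := by simpa using congrArg σ h0
  have hN2 : σ (σ (u - σ u)) = σ (u - σ (σ u)) * (1 + σ x) := by
    have : σ (σ (u - σ u)) = σ (u - σ (σ u)) - σ (u - σ u) := by simp only [map_sub]; ring
    rw [this, h1]; ring
  rw [hN2, h0, eq_div_iff (mul_ne_zero hσD hD)]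
  linear_combination (σ (u - σ (σ u)) * (u - σ (σ u))) * hx

theorem add_fixed_ne_zero {u α : K} (hN : u - σ u ≠ 0) (hα : σ α = α) : u + α ≠ 0 := by
  intro h
  apply hN
  have := congrArg σ h
  simp only [map_add, hα, map_zero] at this
  linear_combination h - this

theorem parametrized_root_eq {u α : K} (hN : u - σ u ≠ 0) (hα : σ α = α) :
    -(σ (σ (u + α)) / σ (u + α)) * ((u - σ u) / (u - σ (σ u))) =
      -(1 - σ (u - σ u) / σ (u + α)) * ((u - σ u) / (u - σ (σ u))) := by
  have he : σ (u + α) ≠ 0 := (map_ne_zero σ).2 (add_fixed_ne_zero σ hN hα)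
  congr 2
  field_simp
  simp only [map_add, map_sub, hα]
  ring

theorem parametrized_root_isRoot {a u α : K} (hN : u - σ u ≠ 0) (hD : u - σ (σ u) ≠ 0)
    (ha : a = σ (σ (u - σ u)) * (u - σ u) / (σ (u - σ (σ u)) * (u - σ (σ u))))
    (hα : σ α = α) {x : K}
    (hx : x = -(σ (σ (u + α)) / σ (u + α)) * ((u - σ u) / (u - σ (σ u)))) :
    σ x * x + x + a = 0 := by
  have he := add_fixed_ne_zero σ hN hα
  have he1 : σ (u + α) ≠ 0 := (map_ne_zero σ).2 he
  have he2 : σ (σ (u + α)) ≠ 0 := (map_ne_zero σ).2 he1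
  have hD1 : σ (u - σ (σ u)) ≠ 0 := (map_ne_zero σ).2 hD
  rw [hx, ha]
  simp only [map_mul, map_neg, map_div₀]
  simp only [map_add, map_sub, hα] at *
  field_simp
  ring

theorem base_root_isRoot {a u x : K} (hD : u - σ (σ u) ≠ 0)
    (ha : a = σ (σ (u - σ u)) * (u - σ u) / (σ (u - σ (σ u)) * (u - σ (σ u))))
    (hx : x = -((u - σ u) / (u - σ (σ u)))) : σ x * x + x + a = 0 := by
  have hD1 : σ (u - σ (σ u)) ≠ 0 := (map_ne_zero σ).2 hD
  rw [hx, ha]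
  simp only [map_neg, map_div₀]
  simp only [map_sub] at *
  field_simp
  ring

theorem eq_parametrized_root (F : Subfield K) (hσF : ∀ x ∈ F, σ x ∈ F) {a u x : K}
    (hu : u ∈ F) (hx : x ∈ F) (hN : u - σ u ≠ 0) (hD : u - σ (σ u) ≠ 0)
    (ha : a = σ (σ (u - σ u)) * (u - σ u) / (σ (u - σ (σ u)) * (u - σ (σ u))))
    (hroot : σ x * x + x + a = 0) (hx0 : x ≠ -((u - σ u) / (u - σ (σ u)))) :
    ∃ α ∈ F, σ α = α ∧
      x = -(σ (σ (u + α)) / σ (u + α)) * ((u - σ u) / (u - σ (σ u))) := by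
  have hN1 : σ (u - σ u) ≠ 0 := (map_ne_zero σ).2 hN
  have hE : (u - σ u) + x * (u - σ (σ u)) ≠ 0 := by
    intro h
    apply hx0
    field_simp
    linear_combination h
  have hE1 : σ ((u - σ u) + x * (u - σ (σ u))) ≠ 0 := (map_ne_zero σ).2 hE
  have hD1 : σ (u - σ (σ u)) ≠ 0 := (map_ne_zero σ).2 hD
  set α := σ (u - σ u) * (u - σ u) / ((u - σ u) + x * (u - σ (σ u))) - σ u with hαdef
  have hαF : α ∈ F := by
    have h1 := hσF u hu
    have h2 := hσF _ h1
    have h3 := F.sub_mem hu h1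
    exact F.sub_mem (F.div_mem (F.mul_mem (hσF _ h3) h3)
      (F.add_mem h3 (F.mul_mem hx (F.sub_mem hu h2)))) h1
  have hα : σ α = α := by
    rw [eq_div_iff (mul_ne_zero hD1 hD)] at ha
    rw [hαdef, map_sub, map_div₀, map_mul]
    simp only [map_add, map_mul, map_sub] at *
    rw [← sub_eq_zero]
    field_simp
    linear_combination ((σ u - σ (σ (σ u))) * (u - σ (σ u)) * (σ u - σ (σ u))) * hroot -
      (σ u - σ (σ u)) * ha
  refine ⟨α, hαF, hα, ?_⟩
  rw [parametrized_root_eq σ hN hα]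
  have : σ (u + α) = σ (u - σ u) * (u - σ u) / ((u - σ u) + x * (u - σ (σ u))) := by
    rw [map_add, hα, hαdef]; ring
  rw [this]
  field_simp
  ring

theorem parametrized_root_injective {u α β : K} (hN : u - σ u ≠ 0) (hD : u - σ (σ u) ≠ 0)
    (hα : σ α = α) (hβ : σ β = β)
    (h : -(σ (σ (u + α)) / σ (u + α)) * ((u - σ u) / (u - σ (σ u))) =
      -(σ (σ (u + β)) / σ (u + β)) * ((u - σ u) / (u - σ (σ u)))) : α = β := by
  have hN1 : σ (u - σ u) ≠ 0 := (map_ne_zero σ).2 hN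
  have hα1 : σ (u + α) ≠ 0 := (map_ne_zero σ).2 (add_fixed_ne_zero σ hN hα)
  have hβ1 : σ (u + β) ≠ 0 := (map_ne_zero σ).2 (add_fixed_ne_zero σ hN hβ)
  rw [parametrized_root_eq σ hN hα, parametrized_root_eq σ hN hβ] at h
  have h' := mul_right_cancel₀ (div_ne_zero hN hD) h
  rw [neg_inj, sub_right_inj, div_eq_div_iff hα1 hβ1] at h'
  have := σ.injective (mul_left_cancel₀ hN1 h')
  exact (add_left_cancel this).symm

theorem parametrized_root_ne_base {u α : K} (hN : u - σ u ≠ 0) (hD : u - σ (σ u) ≠ 0)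
    (hα : σ α = α) :
    -((u - σ u) / (u - σ (σ u))) ≠
      -(σ (σ (u + α)) / σ (u + α)) * ((u - σ u) / (u - σ (σ u))) := by
  have hN1 : σ (u - σ u) ≠ 0 := (map_ne_zero σ).2 hN
  have hα1 : σ (u + α) ≠ 0 := (map_ne_zero σ).2 (add_fixed_ne_zero σ hN hα)
  rw [parametrized_root_eq σ hN hα]
  intro h
  apply mul_ne_zero (div_ne_zero hN1 hα1) (div_ne_zero hN hD)
  linear_combination -h

end Semilinear

section FixedPoints

variable {K : Type*} [Field K] (p : ℕ) [Fact p.Prime] [CharP K p]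

theorem pow_prime_pow_gcd_eq_self {x : K} {i j : ℕ} (hi : x ^ p ^ i = x) (hj : x ^ p ^ j = x) :
    x ^ p ^ Nat.gcd i j = x := by
  have hi' : Function.IsPeriodicPt (frobenius K p) i x := by
    rw [Function.IsPeriodicPt, Function.IsFixedPt, iterate_frobenius, hi]
  have hj' : Function.IsPeriodicPt (frobenius K p) j x := by
    rw [Function.IsPeriodicPt, Function.IsFixedPt, iterate_frobenius, hj]
  have := hi'.gcd hj'
  rwa [Function.IsPeriodicPt, Function.IsFixedPt, iterate_frobenius] at this

theorem pow_prime_pow_eq_self_of_dvd {x : K} {i j : ℕ} (hi : x ^ p ^ i = x) (hij : i ∣ j) :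
    x ^ p ^ j = x := by
  have hi' : Function.IsPeriodicPt (frobenius K p) i x := by
    rw [Function.IsPeriodicPt, Function.IsFixedPt, iterate_frobenius, hi]
  have := hi'.trans_dvd hij
  rwa [Function.IsPeriodicPt, Function.IsFixedPt, iterate_frobenius] at this

theorem iterate_iterateFrobenius_apply (k i : ℕ) (x : K) :
    (iterateFrobenius K p k)^[i] x = x ^ p ^ (k * i) := by
  rw [coe_iterateFrobenius, ← Function.iterate_mul, iterate_frobenius]

theorem ncard_fixedPoints_pow_prime_pow [IsAlgClosed K] {i : ℕ} (hi : i ≠ 0) :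
    {x : K | x ^ p ^ i = x}.ncard = p ^ i := by
  have h1 : 1 < p ^ i := Nat.one_lt_pow hi (Fact.out : p.Prime).one_lt
  have h := card_rootSet_eq_natDegree (K := K)
    (galois_poly_separable (K := K) p (p ^ i) (dvd_pow_self p hi)) (IsAlgClosed.splits_domain _)
  rw [FiniteField.X_pow_card_sub_X_natDegree_eq K h1] at h
  have hset : {x : K | x ^ p ^ i = x} = (X ^ p ^ i - X : K[X]).rootSet K := by
    ext x
    rw [mem_rootSet_of_ne (FiniteField.X_pow_card_sub_X_ne_zero K h1)]
    simp [sub_eq_zero]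
  rw [hset, ← Nat.card_coe_set_eq, Nat.card_eq_fintype_card, h]

/-- The subfield of elements fixed by the `p ^ n`-power Frobenius. -/
def frobeniusFixedField (K : Type*) [Field K] (p : ℕ) [Fact p.Prime] [CharP K p] (n : ℕ) :
    Subfield K :=
  (iterateFrobenius K p n).eqLocusField (RingHom.id K)

theorem mem_frobeniusFixedField {n : ℕ} {x : K} :
    x ∈ frobeniusFixedField K p n ↔ x ^ p ^ n = x := Iff.rfl

theorem independence_iterateFrobenius [IsAlgClosed K] {k n m d k' : ℕ} (hn : n = d * m)
    (hk : k = d * k') (hd : 0 < d) (hcop : Nat.Coprime m k') (hm : 0 < m) (g : ℕ → K)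
    (hg : ∀ t ∈ frobeniusFixedField K p n,
      ∑ i ∈ Finset.range m, g i * (iterateFrobenius K p k)^[i] t = 0) : g 0 = 0 := by
  set σ := iterateFrobenius K p k with hσ
  let f : Fin m → (frobeniusFixedField K p n →* K) := fun i =>
    ((σ ^ (i : ℕ)).comp (frobeniusFixedField K p n).subtype : _ →+* K)
  have hf : ∀ i t, f i t = σ^[i] (t : K) := fun i t => by simp [f]
  have hlt : ∀ i j : Fin m, i < j → f i ≠ f j := by
    intro i j hij h
    obtain ⟨s, hs⟩ := Nat.exists_eq_add_of_lt (Fin.lt_def.1 hij)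
    have hfix : ∀ x : K, x ^ p ^ n = x → x ^ p ^ Nat.gcd n (k * (s + 1)) = x := by
      intro x hx
      refine pow_prime_pow_gcd_eq_self p hx ?_
      have := DFunLike.congr_fun h ⟨x, hx⟩
      rw [hf, hf, hs, add_assoc, Function.iterate_add_apply] at this
      rw [← iterate_iterateFrobenius_apply]
      exact (σ.injective.iterate _ this).symm
    have hn0 : n ≠ 0 := by rw [hn]; positivity
    have hg0 : Nat.gcd n (k * (s + 1)) ≠ 0 := Nat.gcd_ne_zero_left hn0
    have hfin : {x : K | x ^ p ^ Nat.gcd n (k * (s + 1)) = x}.Finite := by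
      apply Set.finite_of_ncard_ne_zero
      rw [ncard_fixedPoints_pow_prime_pow p hg0]
      exact pow_ne_zero _ (Fact.out : p.Prime).ne_zero
    have hle := Set.ncard_le_ncard (s := {x : K | x ^ p ^ n = x})
      (t := {x : K | x ^ p ^ Nat.gcd n (k * (s + 1)) = x}) hfix hfin
    rw [ncard_fixedPoints_pow_prime_pow p hn0, ncard_fixedPoints_pow_prime_pow p hg0,
      Nat.pow_le_pow_iff_right (Fact.out : p.Prime).one_lt] at hle
    have hdvd : n ∣ k * (s + 1) := by
      have := Nat.le_antisymm hle (Nat.gcd_le_left _ (Nat.pos_of_ne_zero hn0))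
      rw [this]
      exact Nat.gcd_dvd_right _ _
    rw [hn, hk, mul_assoc, Nat.mul_dvd_mul_iff_left hd] at hdvd
    have := Nat.le_of_dvd (Nat.succ_pos s) (hcop.dvd_of_dvd_mul_left hdvd)
    have := j.isLt
    omega
  have hinj : Function.Injective f := by
    intro i j h
    rcases lt_trichotomy i j with hij | hij | hij
    · exact (hlt i j hij h).elim
    · exact hij
    · exact (hlt j i hij h.symm).elim
  have hli := (linearIndependent_monoidHom (frobeniusFixedField K p n) K).comp f hinj
  rw [Fintype.linearIndependent_iff] at hli
  refine hli (fun i => g i) ?_ ⟨0, hm⟩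
  ext t
  have := hg t t.2
  rw [← Fin.sum_univ_eq_sum_range (fun i => g i * σ^[i] (t : K))] at this
  simpa [hf] using this

theorem exists_norm_eq_of_fixed [IsAlgClosed K] {k n m d k' : ℕ} (hn : n = d * m)
    (hk : k = d * k') (hcop : Nat.Coprime m k') (hm : 0 < m) {c : K} (hc0 : c ≠ 0)
    (hc : c ^ p ^ d = c) :
    ∃ l ∈ frobeniusFixedField K p n,
      ∏ i ∈ Finset.range m, (iterateFrobenius K p k)^[i] l = c := by
  obtain ⟨P, hP⟩ := Nat.exists_eq_succ_of_ne_zero (pow_ne_zero d (Fact.out : p.Prime).ne_zero)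
  have hgeom := geom_sum_mul_add P m
  have hpos : 0 < ∑ i ∈ Finset.range m, (P + 1) ^ i :=
    Finset.sum_pos (fun i _ => by positivity) (Finset.nonempty_range_iff.2 hm.ne')
  obtain ⟨l, hl⟩ := IsAlgClosed.exists_pow_nat_eq c hpos
  have hcP : c ^ P = 1 := by
    rw [hP, pow_succ] at hc
    exact mul_right_cancel₀ hc0 (by rw [hc, one_mul])
  have hlF : l ^ p ^ n = l := by
    rw [hn, pow_mul, hP, Nat.succ_eq_add_one, ← hgeom, pow_succ, pow_mul, hl, hcP, one_mul]
  refine ⟨l, hlF, ?_⟩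
  have hper : Function.IsPeriodicPt (iterateFrobenius K p d) m l := by
    rw [Function.IsPeriodicPt, Function.IsFixedPt, iterate_iterateFrobenius_apply, ← hn, hlF]
  have hterm : ∀ i, (iterateFrobenius K p k)^[i] l =
      (iterateFrobenius K p d)^[k' * i % m] l := by
    intro i
    rw [hper.iterate_mod_apply, iterate_iterateFrobenius_apply, iterate_iterateFrobenius_apply,
      hk, mul_assoc]
  simp only [hterm]
  have hmaps : Set.MapsTo (fun i => k' * i % m) (Finset.range m) (Finset.range m) :=
    fun i _ => by simpa using Nat.mod_lt _ hm
  have hinj : Set.InjOn (fun i => k' * i % m) (Finset.range m : Set ℕ) := by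
    intro i hi j hj hij
    have h : i ≡ j [MOD m] := Nat.ModEq.cancel_left_of_coprime hcop hij
    exact h.eq_of_lt_of_lt (by simpa using hi) (by simpa using hj)
  rw [← hl, ← Finset.prod_pow_eq_pow_sum]
  refine Finset.prod_nbij (fun i => k' * i % m) hmaps hinj
    (Finset.surjOn_of_injOn_of_card_le _ hmaps hinj le_rfl) fun i _ => ?_
  rw [iterate_iterateFrobenius_apply, pow_mul p, hP]

end FixedPoints

section PowerForms

variable {K : Type*} [Field K] {σ : K →+* K} {q : ℕ}

theorem parameter_value_eq (hσ : ∀ x, σ x = x ^ q) (u : K) :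
    (u - u ^ q) ^ (q ^ 2 + 1) / (u - u ^ q ^ 2) ^ (q + 1) =
      σ (σ (u - σ u)) * (u - σ u) / (σ (u - σ (σ u)) * (u - σ (σ u))) := by
  simp only [hσ, pow_succ, ← pow_mul, pow_zero, one_mul]

theorem base_root_eq (hσ : ∀ x, σ x = x ^ q) (hq : 0 < q) {u : K} (hN : u - σ u ≠ 0)
    (c : K) :
    c / (1 + (u - u ^ q) ^ (q - 1)) = c * ((u - σ u) / (u - σ (σ u))) := by
  have h : (u - u ^ q) ^ (q - 1) = σ (u - σ u) / (u - σ u) := by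
    rw [eq_div_iff hN, ← hσ u, ← pow_succ, Nat.sub_add_cancel hq, hσ (u - σ u)]
  have h' : 1 + σ (u - σ u) / (u - σ u) = (u - σ (σ u)) / (u - σ u) := by
    rw [map_sub]
    field_simp
    ring
  rw [h, h', div_div_eq_mul_div, mul_div_assoc]

theorem pow_sq_sub_eq (hσ : ∀ x, σ x = x ^ q) {e : K} (he : e ≠ 0) :
    e ^ (q ^ 2 - q) = σ (σ e) / σ e := by
  have hle : q ≤ q ^ 2 := Nat.le_self_pow two_ne_zero q
  rw [pow_sub₀ e he hle, hσ, hσ, ← pow_mul, ← sq, div_eq_mul_inv]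

end PowerForms

/-- The characterisation of the parameters with `p ^ d + 1` roots, over any algebraically closed
field of characteristic `p`. -/
theorem roots_characterization {K : Type*} [Field K] [IsAlgClosed K] (p k n : ℕ)
    [Fact p.Prime] [CharP K p] [Algebra (ZMod p) K] (hn : 1 ≤ n)
    (d m q Q : ℕ) (hd : d = Nat.gcd n k) (hm : m = n / d)
    (hq : q = p ^ k) (hQ : Q = p ^ n)
    (A : ℕ → Polynomial (ZMod p)) (hA1 : A 1 = 1) (hA2 : A 2 = -1)
    (hA : ∀ r : ℕ, 1 ≤ r → A (r + 2) = -(A (r + 1)) ^ q - X ^ q * A r ^ q ^ 2)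
    (a : K) (haQ : a ^ Q = a) (ha0 : a ≠ 0) :
    (({x : K | x ^ Q = x ∧ x ^ (q + 1) + x + a = 0}.ncard
        = p ^ d + 1 ↔ aeval a (A m) = 0) ∧
     (aeval a (A m) = 0 ↔ ∃ u : K,
        u ^ Q = u ∧ u ^ p ^ (2 * d) ≠ u ∧
        a = (u - u ^ q) ^ (q ^ 2 + 1) / (u - u ^ q ^ 2) ^ (q + 1))) ∧
    (∀ u : K,
      u ^ Q = u → u ^ p ^ (2 * d) ≠ u →
      a = (u - u ^ q) ^ (q ^ 2 + 1) / (u - u ^ q ^ 2) ^ (q + 1) →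
      {x : K | x ^ Q = x ∧ x ^ (q + 1) + x + a = 0} =
        insert (-1 / (1 + (u - u ^ q) ^ (q - 1)))
          {x : K | ∃ α : K,
            α ^ p ^ d = α ∧
            x = -(u + α) ^ (q ^ 2 - q) / (1 + (u - u ^ q) ^ (q - 1))}) := by
  obtain rfl : q = p ^ k := hq
  obtain rfl : Q = p ^ n := hQ
  have hd0 : 0 < d := hd ▸ Nat.gcd_pos_of_pos_left k hn
  have hndm : n = d * m := by
    rw [hm, Nat.mul_div_cancel' (hd ▸ Nat.gcd_dvd_left n k)]
  obtain ⟨k', hkdk⟩ : d ∣ k := hd ▸ Nat.gcd_dvd_right n k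
  have hcop : Nat.Coprime m k' := by
    have h : d * 1 = d * Nat.gcd m k' := by rw [← Nat.gcd_mul_left, ← hndm, ← hkdk, mul_one, hd]
    exact (Nat.eq_of_mul_eq_mul_left hd0 h).symm
  have hm0 : 0 < m := Nat.pos_of_ne_zero (by rintro rfl; omega)
  obtain ⟨r, rfl⟩ : ∃ r, m = r + 1 := ⟨m - 1, by omega⟩
  have hq0 : 0 < p ^ k := pow_pos (Fact.out : p.Prime).pos k
  set σ := iterateFrobenius K p k
  have hσ : ∀ x, σ x = x ^ p ^ k := fun x => rfl
  have hσσ : ∀ x, σ (σ x) = x ^ p ^ (2 * k) := fun x => by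
    rw [hσ, hσ, ← pow_mul, ← pow_add, two_mul]
  set F := frobeniusFixedField K p n
  have hF : ∀ x, x ∈ F ↔ x ^ p ^ n = x := fun x => mem_frobeniusFixedField p
  have hσF : ∀ x ∈ F, σ x ∈ F := fun x hx => F.pow_mem hx _
  have hσr : ∀ x ∈ F, σ^[r + 1] x = x := fun x hx => by
    rw [iterate_iterateFrobenius_apply]
    refine pow_prime_pow_eq_self_of_dvd p hx ?_
    rw [hndm, hkdk, mul_assoc, mul_left_comm]
    exact Dvd.intro_left k' rfl
  have hfix : ∀ x ∈ F, σ x = x → x ^ p ^ d = x := fun x hx h =>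
    hd ▸ pow_prime_pow_gcd_eq_self p hx h
  have hfixF : ∀ x : K, x ^ p ^ d = x → x ∈ F := fun x hx =>
    pow_prime_pow_eq_self_of_dvd p hx (Dvd.intro _ hndm.symm)
  have hfixσ : ∀ x : K, x ^ p ^ d = x → σ x = x := fun x hx =>
    pow_prime_pow_eq_self_of_dvd p hx (Dvd.intro _ hkdk.symm)
  have hroot : ∀ x : K, x ^ (p ^ k + 1) + x + a = 0 ↔ σ x * x + x + a = 0 := fun x => by
    rw [pow_succ, hσ]
  have hzeros : {x : K | x ^ p ^ n = x ∧ x ^ (p ^ k + 1) + x + a = 0} =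
      {x : K | x ∈ F ∧ σ x * x + x + a = 0} := by
    ext x
    exact and_congr (hF x).symm (hroot x)
  rw [hzeros]
  have hne : ∀ u ∈ F, u ^ p ^ (2 * d) ≠ u → u - σ u ≠ 0 ∧ u - σ (σ u) ≠ 0 := by
    intro u hu hud
    have h2 : u - σ (σ u) ≠ 0 := by
      intro h
      rw [sub_eq_zero, hσσ] at h
      refine hud (pow_prime_pow_eq_self_of_dvd p (pow_prime_pow_gcd_eq_self p hu h.symm) ?_)
      rw [hndm, hkdk, mul_left_comm, Nat.gcd_mul_left, mul_comm 2 d]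
      exact mul_dvd_mul_left d ((Nat.Coprime.gcd_mul_right_cancel_right 2 hcop.symm) ▸
        Nat.gcd_dvd_right _ _)
    refine ⟨fun h => h2 ?_, h2⟩
    rw [sub_eq_zero] at h ⊢
    rw [← h, ← h]
  set b : ℕ → K := fun i => if i = 0 then 0 else aeval a (A i) with hbdef
  have hb0 : b 0 = 0 := rfl
  have hb1 : b 1 = 1 := by simp [hbdef, hA1]
  have hb : ∀ i, b (i + 2) = -σ (b (i + 1)) - σ a * σ (σ (b i)) := by
    rintro (_ | i)
    · simp [hbdef, hA1, hA2]
    · simp only [hbdef, hσ]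
      simp [hA (i + 1) (by omega), ← pow_mul, sq]
  have hbm : aeval a (A (r + 1)) = b (r + 1) := by simp [hbdef]
  rw [hbm]
  have hdesc : ∀ u ∈ F, u ^ p ^ (2 * d) ≠ u →
      a = (u - u ^ p ^ k) ^ ((p ^ k) ^ 2 + 1) / (u - u ^ (p ^ k) ^ 2) ^ (p ^ k + 1) →
      {x : K | x ∈ F ∧ σ x * x + x + a = 0} =
        insert (-((u - σ u) / (u - σ (σ u))))
          ((fun α => -(σ (σ (u + α)) / σ (u + α)) * ((u - σ u) / (u - σ (σ u)))) ''
            {α : K | α ^ p ^ d = α}) := by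
    intro u hu hud hau
    obtain ⟨hN, hD⟩ := hne u hu hud
    rw [parameter_value_eq hσ] at hau
    have hNDF : (u - σ u) / (u - σ (σ u)) ∈ F :=
      F.div_mem (F.sub_mem hu (hσF _ hu)) (F.sub_mem hu (hσF _ (hσF _ hu)))
    ext x
    constructor
    · rintro ⟨hx, hxr⟩
      by_cases hx0 : x = -((u - σ u) / (u - σ (σ u)))
      · exact Or.inl hx0
      · obtain ⟨α, hαF, hα, hxα⟩ := eq_parametrized_root σ F hσF hu hx hN hD hau hxr hx0
        exact Or.inr ⟨α, hfix α hαF hα, hxα.symm⟩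
    · rintro (hx0 | ⟨α, hα, hxα⟩)
      · exact ⟨hx0 ▸ F.neg_mem hNDF, base_root_isRoot σ hD hau hx0⟩
      · refine ⟨?_, parametrized_root_isRoot σ hN hD hau (hfixσ α hα) hxα.symm⟩
        have he := hσF _ (F.add_mem hu (hfixF α hα))
        rw [← hxα]
        exact F.mul_mem (F.neg_mem (F.div_mem (hσF _ he) he)) hNDF
  have h32 : (∃ x ∈ F, ∃ y ∈ F, ∃ z ∈ F, x ≠ y ∧ x ≠ z ∧ y ≠ z ∧ σ x * x + x + a = 0 ∧
      σ y * y + y + a = 0 ∧ σ z * z + z + a = 0) → b (r + 1) = 0 := by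
    rintro ⟨x, hx, y, hy, z, hz, hxy, hxz, hyz, hxr, hyr, hzr⟩
    exact recurrence_eq_zero_of_three_roots σ hb0 hb1 hb r hxy hxz hyz hxr hyr hzr (hσr x hx)
      (hσr y hy) (hσr z hz)
  have h13 : {x : K | x ∈ F ∧ σ x * x + x + a = 0}.ncard = p ^ d + 1 → b (r + 1) = 0 := by
    intro hcard
    have hp := Nat.one_lt_pow hd0.ne' (Fact.out : p.Prime).one_lt
    have h2 : 2 < {x : K | x ∈ F ∧ σ x * x + x + a = 0}.ncard := by omega
    obtain ⟨x, y, z, hx, hy, hz, hxy, hxz, hyz⟩ :=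
      (Set.two_lt_ncard_iff (Set.finite_of_ncard_pos (by omega))).1 h2
    exact h32 ⟨x, hx.1, y, hy.1, z, hz.1, hxy, hxz, hyz, hx.2, hy.2, hz.2⟩
  have h23 : b (r + 1) = 0 → ∃ u : K, u ^ p ^ n = u ∧ u ^ p ^ (2 * d) ≠ u ∧
      a = (u - u ^ p ^ k) ^ ((p ^ k) ^ 2 + 1) / (u - u ^ (p ^ k) ^ 2) ^ (p ^ k + 1) := by
    intro h
    obtain ⟨x, hx, y, hy, z, hz, hxy, hxz, hyz, hxr, hyr, hzr⟩ :=
      three_roots_of_recurrence_eq_zero σ F haQ ha0 hb0 hb1 hb r hσF hσr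
        (independence_iterateFrobenius p hndm hkdk hd0 hcop hm0)
        (fun c hcF hc0 hc => exists_norm_eq_of_fixed p hndm hkdk hcop hm0 hc0 (hfix c hcF hc)) h
    obtain ⟨u, hu⟩ := IsAlgClosed.exists_pow_nat_eq ((z - x) / (z - y)) hq0
    obtain ⟨hu2, hau⟩ := parameter_of_three_roots σ ha0 hxy hxz hyz hxr hyr hzr hu
    refine ⟨u, σ.injective ?_, fun hud => hu2 ?_, by rwa [parameter_value_eq hσ]⟩
    · rw [map_pow, hσ, hu]
      exact F.div_mem (F.sub_mem hz hx) (F.sub_mem hz hy)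
    · rw [hσσ]
      exact (pow_prime_pow_eq_self_of_dvd p hud
        (mul_dvd_mul_left 2 (Dvd.intro _ hkdk.symm))).symm
  have h31 : (∃ u : K, u ^ p ^ n = u ∧ u ^ p ^ (2 * d) ≠ u ∧
      a = (u - u ^ p ^ k) ^ ((p ^ k) ^ 2 + 1) / (u - u ^ (p ^ k) ^ 2) ^ (p ^ k + 1)) →
      {x : K | x ∈ F ∧ σ x * x + x + a = 0}.ncard = p ^ d + 1 := by
    rintro ⟨u, hu, hud, hau⟩
    obtain ⟨hN, hD⟩ := hne u hu hud
    have hcard := ncard_fixedPoints_pow_prime_pow (K := K) p hd0.ne'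
    have hfin : {α : K | α ^ p ^ d = α}.Finite := Set.finite_of_ncard_pos
      (by rw [hcard]; exact pow_pos (Fact.out : p.Prime).pos d)
    rw [hdesc u hu hud hau, Set.ncard_insert_of_notMem ?_ (hfin.image _),
      Set.InjOn.ncard_image ?_, hcard]
    · intro α hα β hβ h
      exact parametrized_root_injective σ hN hD (hfixσ α hα) (hfixσ β hβ) h
    · rintro ⟨α, hα, h⟩
      exact parametrized_root_ne_base σ hN hD (hfixσ α hα) h.symm
  refine ⟨⟨⟨h13, fun h => h31 (h23 h)⟩, ⟨h23, fun h => h13 (h31 h)⟩⟩, fun u hu hud hau => ?_⟩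
  obtain ⟨hN, hD⟩ := hne u hu hud
  rw [hdesc u hu hud hau, base_root_eq hσ hq0 hN, neg_one_mul]
  congr 1
  ext x
  constructor
  · rintro ⟨α, hα, rfl⟩
    refine ⟨α, hα, ?_⟩
    rw [base_root_eq hσ hq0 hN, pow_sq_sub_eq hσ (add_fixed_ne_zero σ hN (hfixσ α hα))]
  · rintro ⟨α, hα, rfl⟩
    refine ⟨α, hα, ?_⟩
    rw [base_root_eq hσ hq0 hN, pow_sq_sub_eq hσ (add_fixed_ne_zero σ hN (hfixσ α hα))]

theorem stmt_7 (p k n : ℕ) [Fact p.Prime] (hk : 1 ≤ k) (hn : 1 ≤ n)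
    (d m q Q : ℕ) (hd : d = Nat.gcd n k) (hm : m = n / d)
    (hq : q = p ^ k) (hQ : Q = p ^ n)
    (A : ℕ → Polynomial (ZMod p)) (hA1 : A 1 = 1) (hA2 : A 2 = -1)
    (hA : ∀ r : ℕ, 1 ≤ r → A (r + 2) = -(A (r + 1)) ^ q - X ^ q * A r ^ q ^ 2)
    (a : AlgebraicClosure (ZMod p)) (haQ : a ^ Q = a) (ha0 : a ≠ 0) :
    (({x : AlgebraicClosure (ZMod p) | x ^ Q = x ∧ x ^ (q + 1) + x + a = 0}.ncard
        = p ^ d + 1 ↔ aeval a (A m) = 0) ∧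
     (aeval a (A m) = 0 ↔ ∃ u : AlgebraicClosure (ZMod p),
        u ^ Q = u ∧ u ^ p ^ (2 * d) ≠ u ∧
        a = (u - u ^ q) ^ (q ^ 2 + 1) / (u - u ^ q ^ 2) ^ (q + 1))) ∧
    (∀ u : AlgebraicClosure (ZMod p),
      u ^ Q = u → u ^ p ^ (2 * d) ≠ u →
      a = (u - u ^ q) ^ (q ^ 2 + 1) / (u - u ^ q ^ 2) ^ (q + 1) →
      {x : AlgebraicClosure (ZMod p) | x ^ Q = x ∧ x ^ (q + 1) + x + a = 0} =
        insert (-1 / (1 + (u - u ^ q) ^ (q - 1)))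
          {x : AlgebraicClosure (ZMod p) | ∃ α : AlgebraicClosure (ZMod p),
            α ^ p ^ d = α ∧
            x = -(u + α) ^ (q ^ 2 - q) / (1 + (u - u ^ q) ^ (q - 1))}) :=
  roots_characterization p k n hn d m q Q hd hm hq hQ A hA1 hA2 hA a haQ ha0
end
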